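/- arXiv:2103.13735 — 3 statements merged into one kernel-verified Lean document; each statement's English description precedes it below -/
import Mathlib

section
/- Let f = (f_1,…,f_s) ⊂ ℚ[y][x] satisfy Assumptions A and B, and for 1 ≤ i ≤ d+1 let Δ_i^A denote the set of (n−d)-minors of the Jacobian matrix of f^A with respect to the variables x_{i+1},…,x_n only. There exists a nonempty Zariski open subset Õ of the group of invertible (n+t)×(n+t) matrices over the algebraic closure of ℂ(y) acting on x and fixing y, such that for every A ∈ Õ ∩ GL(n,t,ℚ) and every 1 ≤ i ≤ d+1 and every i ≤ j ≤ n, there exists a polynomial p_{i,j} ∈ ℚ(y)[x_1,…,x_{i−1},x_j] lying in the ideal of ℚ(y)[x] generated by f^A ∪ Δ_i^A which is monic as a polynomial in x_j with coefficients in ℚ(y)[x_1,…,x_{i−1}]; equivalently, the variables (x_i,…,x_n) are in Noether position with respect to that ideal. -/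
open MvPolynomial

noncomputable section

/-- The common zero locus in `F^σ` of a set of polynomials. -/
def zLocus {σ F : Type*} [CommSemiring F] (S : Set (MvPolynomial σ F)) : Set (σ → F) :=
  {x | ∀ p ∈ S, eval x p = 0}

/-- The vanishing ideal of a subset of `F^σ`. -/
def vIdeal {σ F : Type*} [CommRing F] (V : Set (σ → F)) : Ideal (MvPolynomial σ F) where
  carrier := {p | ∀ x ∈ V, eval x p = 0}
  add_mem' := by
    intro p q hp hq x hx
    simp [hp x hx, hq x hx]
  zero_mem' := by intro x hx; simp
  smul_mem' := by
    intro c p hp x hx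
    simp [smul_eq_mul, hp x hx]

/-- The dimension of an algebraic set, as the Krull dimension of its coordinate ring. -/
def setDim {σ : Type*} (V : Set (σ → ℂ)) : WithBot (WithTop ℕ) :=
  ringKrullDim (MvPolynomial σ ℂ ⧸ vIdeal V)

/-- An ideal is equidimensional of dimension `d` if every minimal prime over it has
quotient of Krull dimension `d`. -/
def EquidimIdeal {R : Type*} [CommRing R] (I : Ideal R) (d : ℕ) : Prop :=
  ∀ P ∈ I.minimalPrimes, ringKrullDim (R ⧸ P) = (d : WithBot (WithTop ℕ))

/-- Differential at a point `p₀` of the polynomial `g`, applied to the vector `v`. -/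
def polyDiff {σ : Type*} [Fintype σ] [DecidableEq σ] (p₀ : σ → ℂ) (g : MvPolynomial σ ℂ)
    (v : σ → ℂ) : ℂ :=
  ∑ j, v j * eval p₀ (pderiv j g)

/-- The Zariski tangent space of `V` at `p₀`. -/
def tangentAt {σ : Type*} [Fintype σ] [DecidableEq σ] (V : Set (σ → ℂ)) (p₀ : σ → ℂ) :
    Submodule ℂ (σ → ℂ) where
  carrier := {v | ∀ g ∈ vIdeal V, polyDiff p₀ g v = 0}
  add_mem' := by
    intro a b ha hb g hg
    have h1 := ha g hg
    have h2 := hb g hg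
    simp only [polyDiff, Pi.add_apply, add_mul, Finset.sum_add_distrib] at *
    simp [h1, h2]
  zero_mem' := by intro g hg; simp [polyDiff]
  smul_mem' := by
    intro c a ha g hg
    have h1 := ha g hg
    simp only [polyDiff, Pi.smul_apply, smul_eq_mul, mul_assoc, ← Finset.mul_sum] at *
    simp [h1]

/-- The singular locus of `V`, relative to the expected dimension `d`:
points of `V` where the Zariski tangent space does not have dimension `d`. -/
def singLocus {σ : Type*} [Fintype σ] [DecidableEq σ] (V : Set (σ → ℂ)) (d : ℕ) :
    Set (σ → ℂ) :=
  {p | p ∈ V ∧ Module.finrank ℂ (tangentAt V p) ≠ d}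

/-- Critical points of the polynomial map with components `φ` restricted to the
nonsingular locus of `V` (`V` of expected dimension `d`). -/
def critMap {σ : Type*} [Fintype σ] [DecidableEq σ] {ι : Type*}
    (V : Set (σ → ℂ)) (d : ℕ) (φ : ι → MvPolynomial σ ℂ) : Set (σ → ℂ) :=
  {p | p ∈ V ∧ p ∉ singLocus V d ∧
    ¬ Function.Surjective (fun v : tangentAt V p => fun k : ι => polyDiff p (φ k) v)}

/-- The components of the projection on the first `i` coordinates, as polynomials. -/
def projPoly (n i : ℕ) : Fin i → MvPolynomial (Fin n) ℂ :=
  fun k => if h : (k : ℕ) < n then X ⟨k, h⟩ else 0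

/-- Critical locus of the projection to the first `i` coordinates restricted to `V`,
with the convention that for `i = d+1` it is all of `V`. -/
def critProj {n : ℕ} (V : Set (Fin n → ℂ)) (d i : ℕ) : Set (Fin n → ℂ) :=
  if i = d + 1 then V else critMap V d (projPoly n i)

/-- Projection of `ℂ^n` to the first `i` coordinates. -/
def projMap (n i : ℕ) (x : Fin n → ℂ) : Fin i → ℂ :=
  fun k => if h : (k : ℕ) < n then x ⟨k, h⟩ else 0

/-- `φ` restricted to `V` is proper at `β` (Euclidean topology). -/
def ProperAt {n i : ℕ} (φ : (Fin n → ℂ) → Fin i → ℂ) (V : Set (Fin n → ℂ))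
    (β : Fin i → ℂ) : Prop :=
  ∃ O : Set (Fin i → ℂ), IsOpen O ∧ β ∈ O ∧ IsCompact {x | x ∈ V ∧ φ x ∈ closure O}

/-- `φ` restricted to `V` is a proper map (onto its image). -/
def ProperOn {n i : ℕ} (φ : (Fin n → ℂ) → Fin i → ℂ) (V : Set (Fin n → ℂ)) : Prop :=
  ∀ β ∈ φ '' V, ProperAt φ V β

/-- Zariski open subsets of `F^k`: complements of zero loci of sets of polynomials. -/
def IsZariskiOpen {k : ℕ} {F : Type*} [CommSemiring F] (U : Set (Fin k → F)) : Prop :=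
  ∃ S : Set (MvPolynomial (Fin k) F), U = {x | ∃ p ∈ S, eval x p ≠ 0}

/-- Zariski open subsets of the space of `n × n` matrices over `F`. -/
def IsZariskiOpenMat {n : ℕ} {F : Type*} [CommSemiring F]
    (U : Set (Matrix (Fin n) (Fin n) F)) : Prop :=
  ∃ S : Set (MvPolynomial (Fin n × Fin n) F),
    U = {A | ∃ p ∈ S, eval (fun q => A q.1 q.2) p ≠ 0}

/-- Complexification of a rational polynomial. -/
def toC {σ : Type*} (p : MvPolynomial σ ℚ) : MvPolynomial σ ℂ :=
  MvPolynomial.map (algebraMap ℚ ℂ) p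

/-- The change of variables `x ↦ A·x` acting on the `x`-variables only
(the `y`-variables are left invariant). -/
def chgX {n t : ℕ} {F : Type*} [CommRing F] (A : Matrix (Fin n) (Fin n) F)
    (p : MvPolynomial (Fin n ⊕ Fin t) F) : MvPolynomial (Fin n ⊕ Fin t) F :=
  aeval (Sum.elim (fun j => ∑ k, C (A j k) * X (Sum.inl k)) (fun l => X (Sum.inr l))) p

/-- Specialization of the `y`-variables at the point `η`. -/
def specY {n t : ℕ} {F : Type*} [CommRing F] (η : Fin t → F)
    (p : MvPolynomial (Fin n ⊕ Fin t) F) : MvPolynomial (Fin n) F :=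
  aeval (Sum.elim X (fun l => C (η l))) p

/-- Jacobian matrix w.r.t. the `x`-variables, evaluated at a point `z ∈ ℂ^{n+t}`. -/
def jacXAt {n t s : ℕ} (f : Fin s → MvPolynomial (Fin n ⊕ Fin t) ℂ)
    (z : (Fin n ⊕ Fin t) → ℂ) : Matrix (Fin s) (Fin n) ℂ :=
  Matrix.of fun i j => eval z (pderiv (Sum.inl j) (f i))

/-- Symbolic Jacobian matrix of a polynomial system in the variables `x`. -/
def jacPoly {n s : ℕ} {F : Type*} [CommRing F] (g : Fin s → MvPolynomial (Fin n) F) :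
    Matrix (Fin s) (Fin n) (MvPolynomial (Fin n) F) :=
  Matrix.of fun i j => pderiv j (g i)

/-- Symbolic Jacobian matrix w.r.t. the `x`-variables of a system in variables `(x,y)`. -/
def jacPolyX {n t s : ℕ} {F : Type*} [CommRing F]
    (f : Fin s → MvPolynomial (Fin n ⊕ Fin t) F) :
    Matrix (Fin s) (Fin n) (MvPolynomial (Fin n ⊕ Fin t) F) :=
  Matrix.of fun i j => pderiv (Sum.inl j) (f i)

/-- The set of `k`-minors of `M` using only columns of index `≥ i` (0-indexed). -/
def minorsGE {s n : ℕ} {R : Type*} [CommRing R] (M : Matrix (Fin s) (Fin n) R)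
    (k i : ℕ) : Set R :=
  {q | ∃ (r : Fin k → Fin s) (c : Fin k → Fin n), Function.Injective r ∧
        Function.Injective c ∧ (∀ l, i ≤ (c l : ℕ)) ∧ q = (M.submatrix r c).det}

/-- Semi-algebraic formulas over `ℚ[y_1,…,y_t]`: boolean combinations of polynomial
sign conditions. -/
inductive SAForm (t : ℕ) : Type
  | eq (p : MvPolynomial (Fin t) ℚ) : SAForm t
  | pos (p : MvPolynomial (Fin t) ℚ) : SAForm t
  | nonneg (p : MvPolynomial (Fin t) ℚ) : SAForm t
  | ne (p : MvPolynomial (Fin t) ℚ) : SAForm t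
  | conj (φ ψ : SAForm t) : SAForm t
  | disj (φ ψ : SAForm t) : SAForm t
  | neg (φ : SAForm t) : SAForm t

/-- Truth value of a semi-algebraic formula at a point of `ℝ^t`. -/
def SAForm.holds {t : ℕ} : SAForm t → (Fin t → ℝ) → Prop
  | eq p, y => aeval y p = 0
  | pos p, y => 0 < aeval y p
  | nonneg p, y => 0 ≤ aeval y p
  | ne p, y => aeval y p ≠ 0
  | conj φ ψ, y => φ.holds y ∧ ψ.holds y
  | disj φ ψ, y => φ.holds y ∨ ψ.holds y
  | neg φ, y => ¬ φ.holds y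

/-- The maximal total degree of the polynomials involved in a semi-algebraic formula. -/
def SAForm.deg {t : ℕ} : SAForm t → ℕ
  | eq p => p.totalDegree
  | pos p => p.totalDegree
  | nonneg p => p.totalDegree
  | ne p => p.totalDegree
  | conj φ ψ => max φ.deg ψ.deg
  | disj φ ψ => max φ.deg ψ.deg
  | neg φ => φ.deg

/-- The solution set `Z(Φ) ⊆ ℝ^t` of a semi-algebraic formula. -/
def SAForm.zset {t : ℕ} (φ : SAForm t) : Set (Fin t → ℝ) := {y | φ.holds y}

/-- The real points of the variety defined by a rational system in variables `(x, y)`. -/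
def realPts {n t s : ℕ} (f : Fin s → MvPolynomial (Fin n ⊕ Fin t) ℚ) :
    Set ((Fin n ⊕ Fin t) → ℝ) :=
  {z | ∀ i, aeval z (f i) = 0}

/-- The real zero set of a set of rational polynomials. -/
def realZeros {σ : Type*} (S : Set (MvPolynomial σ ℚ)) : Set (σ → ℝ) :=
  {z | ∀ p ∈ S, aeval z p = 0}

/-- The projection `(x, y) ↦ y` on real points. -/
def projY {n t : ℕ} (z : (Fin n ⊕ Fin t) → ℝ) : Fin t → ℝ := z ∘ Sum.inr

/-- The projection `(x, y) ↦ y` on complex points. -/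
def projYC {n t : ℕ} (z : (Fin n ⊕ Fin t) → ℂ) : Fin t → ℂ := z ∘ Sum.inr

/-- The complex algebraic set defined by a rational polynomial system. -/
def VC {n t s : ℕ} (f : Fin s → MvPolynomial (Fin n ⊕ Fin t) ℚ) :
    Set ((Fin n ⊕ Fin t) → ℂ) :=
  zLocus (Set.range fun i => toC (f i))

/-- Assumption A: the ideal generated by `f` is radical, and its algebraic set is
(nonempty) equidimensional of dimension `d + t` with singular locus of dimension `< t`. -/
def AssumpA {n t s : ℕ} (f : Fin s → MvPolynomial (Fin n ⊕ Fin t) ℚ) (d : ℕ) : Prop :=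
  (Ideal.span (Set.range f)).IsRadical ∧
  (VC f).Nonempty ∧
  EquidimIdeal (vIdeal (VC f)) (d + t) ∧
  setDim (singLocus (VC f) (d + t)) < (t : WithBot (WithTop ℕ))

/-- Assumption B: the Zariski closure of `π(V)` is all of `ℂ^t` (no nonzero polynomial
vanishes on `π(V)`), and `π(V ∩ ℝ^{t+n})` has nonzero Lebesgue measure. -/
def AssumpB {n t s : ℕ} (f : Fin s → MvPolynomial (Fin n ⊕ Fin t) ℚ) : Prop :=
  (∀ p : MvPolynomial (Fin t) ℂ, (∀ z ∈ VC f, eval (projYC z) p = 0) → p = 0) ∧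
  MeasureTheory.volume (projY '' realPts f) ≠ 0

/-- The conclusion of Lemma (B-param): the system `g` generates a radical
equidimensional ideal whose algebraic set is either empty or smooth of dimension `d`. -/
def GoodSpec {n s : ℕ} (g : Fin s → MvPolynomial (Fin n) ℂ) (d : ℕ) : Prop :=
  (Ideal.span (Set.range g)).IsRadical ∧
  (zLocus (Set.range g) = ∅ ∨
    (EquidimIdeal (Ideal.span (Set.range g)) d ∧ singLocus (zLocus (Set.range g)) d = ∅))

/-- The field `ℚ(y_1, …, y_t)` of rational fractions. -/
abbrev RatFunc' (t : ℕ) : Type := FractionRing (MvPolynomial (Fin t) ℚ)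

/-- View a polynomial of `ℚ[x, y]` as a polynomial of `ℚ(y)[x]`. -/
def toKx {n t : ℕ} (p : MvPolynomial (Fin n ⊕ Fin t) ℚ) :
    MvPolynomial (Fin n) (RatFunc' t) :=
  eval₂ ((C : RatFunc' t →+* MvPolynomial (Fin n) (RatFunc' t)).comp
      ((algebraMap (MvPolynomial (Fin t) ℚ) (RatFunc' t)).comp (C : ℚ →+* MvPolynomial (Fin t) ℚ)))
    (Sum.elim X (fun l => C (algebraMap (MvPolynomial (Fin t) ℚ) (RatFunc' t) (X l)))) p

/-- Extension of a vector of `Fin d` to a function on `ℕ` (by zero). -/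
def extFun {d : ℕ} {F : Type*} [Zero F] (α : Fin d → F) : ℕ → F :=
  fun k => if h : k < d then α ⟨k, h⟩ else 0

/-- The polynomial system `W_i^{A,α}` (over the ground field `F`, the change of
variables being already performed): the input equations, the `(n-d)`-minors of the
truncated Jacobian (except when `i = d+1`), and the equations `x_k = α_k`, `k ≤ i-1`. -/
def Wsys {n s : ℕ} {F : Type*} [CommRing F] (g : Fin s → MvPolynomial (Fin n) F)
    (d i : ℕ) (a : ℕ → F) : Set (MvPolynomial (Fin n) F) :=
  Set.range g ∪ (if i = d + 1 then ∅ else minorsGE (jacPoly g) (n - d) i) ∪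
  {q | ∃ k : Fin n, (k : ℕ) < i - 1 ∧ q = X k - C (a k)}

/-- The polynomial system `W_i^{A,α}` viewed in `ℚ[y][x]` (variables `(x,y)`). -/
def WsysXY {n t s : ℕ} (f : Fin s → MvPolynomial (Fin n ⊕ Fin t) ℚ)
    (d i : ℕ) (a : ℕ → ℚ) : Set (MvPolynomial (Fin n ⊕ Fin t) ℚ) :=
  Set.range f ∪ (if i = d + 1 then ∅ else minorsGE (jacPolyX f) (n - d) i) ∪
  {q | ∃ k : Fin n, (k : ℕ) < i - 1 ∧ q = X (Sum.inl k) - C (a k)}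

/-- A commutative ring is Cohen–Macaulay if, for every maximal ideal `m`, there is a
regular sequence contained in `m` of length the height of `m`. -/
def IsCMRing (R : Type*) [CommRing R] : Prop :=
  ∀ m : Ideal R, ∀ hm : m.IsMaximal, ∃ rs : List R,
    (∀ r ∈ rs, r ∈ m) ∧ RingTheory.Sequence.IsRegular R rs ∧
    (rs.length : WithBot (WithTop ℕ)) = ringKrullDim (@Localization.AtPrime R _ m hm.isPrime)

/-- Homogenization of a polynomial w.r.t. all its variables, using a fresh variable. -/
def homog {σ : Type*} {F : Type*} [CommSemiring F] [DecidableEq σ] (p : MvPolynomial σ F) :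
    MvPolynomial (σ ⊕ Unit) F :=
  p.support.sum fun m =>
    monomial (m.mapDomain Sum.inl +
        Finsupp.single (Sum.inr ()) (p.totalDegree - m.sum fun _ e => e)) (coeff m p)

/-- Zariski open subsets of the space `ℂ[x,y]^s_{≤D}` of `s`-tuples of polynomials of
total degree at most `D`, described by polynomial conditions on the coefficients. -/
def IsZariskiOpenTuple {n t : ℕ} (s D : ℕ)
    (U : Set (Fin s → MvPolynomial (Fin n ⊕ Fin t) ℂ)) : Prop :=
  ∃ S : Set (MvPolynomial (Fin s × ((Fin n ⊕ Fin t) →₀ ℕ)) ℂ),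
    U = {f | (∀ i, (f i).totalDegree ≤ D) ∧
          ∃ p ∈ S, eval (fun im => coeff im.2 (f im.1)) p ≠ 0}

/-- Zariski open subsets of the product of the space of `n×n` complex matrices with `ℂ^n`. -/
def IsZariskiOpenMatVec {n : ℕ}
    (U : Set (Matrix (Fin n) (Fin n) ℂ × (Fin n → ℂ))) : Prop :=
  ∃ S : Set (MvPolynomial ((Fin n × Fin n) ⊕ Fin n) ℂ),
    U = {Aα | ∃ p ∈ S, eval (Sum.elim (fun q => Aα.1 q.1 q.2) Aα.2) p ≠ 0}


open scoped IntermediateField.algebraAdjoinAdjoin in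
theorem formallyEtale_adjoin_of_basis {k0 E ι : Type} [Field k0] [CharZero k0] [Field E]
    [Algebra k0 E] (v : ι → E) (hv : IsTranscendenceBasis k0 v) :
    Algebra.FormallyEtale (Algebra.adjoin k0 (Set.range v)) E := by
  have hsep : Algebra.IsAlgebraic (IntermediateField.adjoin k0 (Set.range v)) E :=
    hv.isAlgebraic_field
  have h1 : Algebra.FormallyEtale (Algebra.adjoin k0 (Set.range v))
      (IntermediateField.adjoin k0 (Set.range v)) := .of_isLocalization (nonZeroDivisors _)
  have h2 : Algebra.FormallyEtale (IntermediateField.adjoin k0 (Set.range v)) E :=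
    Algebra.FormallyEtale.of_isSeparable _ E
  exact .comp _ (IntermediateField.adjoin k0 (Set.range v)) _

theorem exists_derivation_of_basis {k0 E ι : Type} [Field k0] [CharZero k0] [Field E] [Algebra k0 E]
    (v : ι → E) (hv : IsTranscendenceBasis k0 v) (b : ι) :
    ∃ D : Derivation k0 E E, D (v b) = 1 ∧ ∀ l, l ≠ b → D (v l) = 0 := by
  classical
  have := formallyEtale_adjoin_of_basis v hv
  let e := hv.1.aevalEquiv
  have he : ∀ l, e (X l) = ⟨v l, Algebra.subset_adjoin ⟨l, rfl⟩⟩ := by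
    intro l; ext; simp [e]
  let d0 : Derivation k0 (Algebra.adjoin k0 (Set.range v)) (Algebra.adjoin k0 (Set.range v)) :=
    Derivation.mk' (e.toLinearMap ∘ₗ (pderiv b).toLinearMap ∘ₗ e.symm.toLinearMap) (by
      intro x y
      simp [mul_comm])
  have hd0 : ∀ l, d0 ⟨v l, Algebra.subset_adjoin ⟨l, rfl⟩⟩ = if l = b then 1 else 0 := by
    intro l
    rw [← he]
    show e (pderiv b (e.symm (e (X l)))) = _
    rw [e.symm_apply_apply, pderiv_X]
    split_ifs with h
    · subst h; simp
    · rw [Pi.single_eq_of_ne (fun h' => h h')]; simp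
  let d1 : Derivation k0 (Algebra.adjoin k0 (Set.range v)) E :=
    (Algebra.linearMap (Algebra.adjoin k0 (Set.range v)) E).compDer d0
  let L : Ω[E⁄k0] →ₗ[E] E :=
    (LinearMap.liftBaseChange E d1.liftKaehlerDifferential) ∘ₗ
    (KaehlerDifferential.tensorKaehlerEquivOfFormallyEtale k0
      (Algebra.adjoin k0 (Set.range v)) E).symm.toLinearMap
  let D : Derivation k0 E E := L.compDer (KaehlerDifferential.D k0 E)
  have hD : ∀ l, D (v l) = if l = b then 1 else 0 := by
    intro l
    have h1 := KaehlerDifferential.tensorKaehlerEquivOfFormallyEtale_symm_D_algebraMap k0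
      (Algebra.adjoin k0 (Set.range v)) E ⟨v l, Algebra.subset_adjoin ⟨l, rfl⟩⟩
    have h2 : D (v l) = LinearMap.liftBaseChange E d1.liftKaehlerDifferential
       ((KaehlerDifferential.tensorKaehlerEquivOfFormallyEtale k0
      (Algebra.adjoin k0 (Set.range v)) E).symm (KaehlerDifferential.D k0 E (v l))) := rfl
    rw [h2]
    erw [h1]
    rw [LinearMap.liftBaseChange_tmul, Derivation.liftKaehlerDifferential_comp_D, one_smul]
    show algebraMap _ E (d0 _) = _
    rw [hd0]; split_ifs <;> simp
  exact ⟨D, by simp [hD], fun l hl => by simp [hD, hl]⟩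

theorem exists_derivation_of_algInd {k0 E ι : Type} [Field k0] [CharZero k0] [Field E] [Algebra k0 E]
    (v : ι → E) (hv : AlgebraicIndependent k0 v) (b : ι) :
    ∃ D : Derivation k0 E E, D (v b) = 1 ∧ ∀ l, l ≠ b → D (v l) = 0 := by
  classical
  obtain ⟨s, hs, hst⟩ := exists_isTranscendenceBasis_superset hv.coe_range
  obtain ⟨D, h1, h2⟩ := exists_derivation_of_basis _ hst ⟨v b, hs ⟨b, rfl⟩⟩
  refine ⟨D, h1, fun l hl => h2 ⟨v l, hs ⟨l, rfl⟩⟩ fun h => hl (hv.injective ?_)⟩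
  exact congrArg Subtype.val h

theorem exists_col_sel {E m c : Type} [Field E] [Fintype m] [Fintype c] (N : Matrix m c E) (k : ℕ)
    (h : k ≤ N.rank) : ∃ g : Fin k → c, LinearIndependent E (fun l => N.col (g l)) := by
  rw [Matrix.rank_eq_finrank_span_cols] at h
  obtain ⟨f, hf, -, hli⟩ := Submodule.exists_fun_fin_finrank_span_eq E (Set.range N.col)
  choose g hg using hf
  refine ⟨fun l => g (Fin.castLE h l), ?_⟩
  simp only [hg]
  exact hli.comp _ (Fin.castLE_injective h)

theorem exists_minor_ne_zero {E m c : Type} [Field E] [Fintype m] [Fintype c] (N : Matrix m c E)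
    (k : ℕ) (h : k ≤ N.rank) : ∃ (r : Fin k → m) (g : Fin k → c), Function.Injective r ∧
      Function.Injective g ∧ (N.submatrix r g).det ≠ 0 := by
  obtain ⟨g, hg⟩ := exists_col_sel N k h
  have h2 : k ≤ (N.submatrix id g).transpose.rank := by
    rw [Matrix.rank_transpose, Matrix.rank_eq_finrank_span_cols]
    have := finrank_span_eq_card hg
    rw [Fintype.card_fin] at this
    exact this.ge
  obtain ⟨r, hr⟩ := exists_col_sel _ k h2
  have h3 : LinearIndependent E (N.submatrix r g).row := hr
  refine ⟨r, g, ?_, ?_, ?_⟩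
  · exact fun a b hab => hr.injective (by simp [hab])
  · exact fun a b hab => hg.injective (by simp [hab])
  · rw [Matrix.linearIndependent_rows_iff_isUnit, Matrix.isUnit_iff_isUnit_det] at h3
    exact h3.ne_zero

theorem le_rank_of_minor {E m c : Type} [Field E] [Fintype m] [Fintype c] (N : Matrix m c E)
    (k : ℕ) (r : Fin k → m) (g : Fin k → c) (h : (N.submatrix r g).det ≠ 0) : k ≤ N.rank := by
  have h1 : (N.submatrix r g).rank = k := by
    rw [Matrix.rank_of_isUnit _ ((Matrix.isUnit_iff_isUnit_det _).2 h.isUnit), Fintype.card_fin]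
  exact h1 ▸ Matrix.rank_submatrix_le _ _ _

/-- If the columns in `T` are combinations of the columns outside `T`, the rank does not change. -/
theorem rank_le_of_kernel {E m c : Type} [Field E] [Fintype m] [Fintype c]
    (N : Matrix m c E) (T : Set c) [Fintype (Tᶜ : Set c)]
    (h : ∀ b ∈ T, ∃ w : c → E, w b = 1 ∧ (∀ l ∈ T, l ≠ b → w l = 0) ∧ N.mulVec w = 0) :
    N.rank ≤ (N.submatrix id (Subtype.val : (Tᶜ : Set c) → c)).rank := by
  classical
  rw [Matrix.rank_eq_finrank_span_cols, Matrix.rank_eq_finrank_span_cols]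
  apply Submodule.finrank_mono
  rw [Submodule.span_le]
  rintro _ ⟨b, rfl⟩
  have hout : ∀ l ∉ T, N.col l ∈ Submodule.span E
      (Set.range (N.submatrix id (Subtype.val : (Tᶜ : Set c) → c)).col) :=
    fun l hl => Submodule.subset_span ⟨⟨l, hl⟩, rfl⟩
  by_cases hb : b ∈ T
  · obtain ⟨w, w1, w2, w3⟩ := h b hb
    have : ∑ l, w l • N.col l = 0 := by
      rw [← w3]; ext i
      simp [Matrix.mulVec, dotProduct, Matrix.col, mul_comm]
    rw [← Finset.add_sum_erase _ _ (Finset.mem_univ b), w1, one_smul] at this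
    rw [eq_neg_of_add_eq_zero_left this]
    refine neg_mem (sum_mem fun l hl => ?_)
    by_cases hlT : l ∈ T
    · rw [w2 l hlT (Finset.ne_of_mem_erase hl), zero_smul]; exact zero_mem _
    · exact Submodule.smul_mem _ _ (hout l hlT)
  · exact hout b hb

theorem exists_point_of_disjoint {k0 σ : Type} [Field k0] (T : Set σ)
    (J : Ideal (MvPolynomial σ k0)) (hJ : ∀ p ∈ supported k0 T, p ∈ J → p = 0) :
    ∃ (E : Type) (_ : Field E) (_ : Algebra k0 E) (ψ : MvPolynomial σ k0 →ₐ[k0] E),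
      (∀ p ∈ J, ψ p = 0) ∧ (∀ p ∈ supported k0 T, ψ p = 0 → p = 0) := by
  let S : Submonoid (MvPolynomial σ k0) :=
    { carrier := {p | p ∈ supported k0 T ∧ p ≠ 0}
      mul_mem' := fun {a b} ha hb => ⟨mul_mem ha.1 hb.1, mul_ne_zero ha.2 hb.2⟩
      one_mem' := ⟨one_mem _, one_ne_zero⟩ }
  have hd : Disjoint (J : Set (MvPolynomial σ k0)) (S : Set (MvPolynomial σ k0)) := by
    rw [Set.disjoint_left]
    intro p hp hS
    exact hS.2 (hJ p hS.1 hp)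
  obtain ⟨P, hP, hJP, hPS⟩ := Ideal.exists_le_prime_disjoint J S hd
  refine ⟨FractionRing (MvPolynomial σ k0 ⧸ P), inferInstance, inferInstance,
    (IsScalarTower.toAlgHom k0 (MvPolynomial σ k0 ⧸ P) _).comp (Ideal.Quotient.mkₐ k0 P), ?_, ?_⟩
  · intro p hp
    have : Ideal.Quotient.mk P p = 0 := Ideal.Quotient.eq_zero_iff_mem.2 (hJP hp)
    simp [this]
  · intro p hp h0
    by_contra hne
    have h1 : Ideal.Quotient.mk P p = 0 := by
      apply IsFractionRing.injective (MvPolynomial σ k0 ⧸ P)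
        (FractionRing (MvPolynomial σ k0 ⧸ P))
      simpa using h0
    exact Set.disjoint_left.1 hPS (Ideal.Quotient.eq_zero_iff_mem.1 h1) ⟨hp, hne⟩

theorem derivation_chain {k0 σ E : Type} [Field k0] [Fintype σ] [Field E] [Algebra k0 E]
    (ψ : MvPolynomial σ k0 →ₐ[k0] E) (D : Derivation k0 E E) (p : MvPolynomial σ k0) :
    D (ψ p) = ∑ j, ψ (pderiv j p) * D (ψ (X j)) := by
  classical
  induction p using MvPolynomial.induction_on with
  | C a =>
    rw [← algebraMap_eq, AlgHom.commutes]; simp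
  | add p q hp hq => simp [hp, hq, add_mul, Finset.sum_add_distrib]
  | mul_X p i hp =>
    rw [map_mul, D.leibniz, hp]
    simp only [Derivation.leibniz, smul_eq_mul, map_add, map_mul, add_mul, Finset.sum_add_distrib,
      Finset.mul_sum]
    congr 1
    · rw [Finset.sum_eq_single i]
      · simp
      · intro b _ hb
        rw [pderiv_X_of_ne hb.symm]; simp
      · simp
    · exact Finset.sum_congr rfl fun j _ => by ring

theorem sard_rank {k0 σ m E : Type} [Field k0] [CharZero k0] [Fintype σ] [Fintype m]
    [Field E] [Algebra k0 E] (T : Set σ) [Fintype (Tᶜ : Set σ)]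
    (ψ : MvPolynomial σ k0 →ₐ[k0] E)
    (hT : ∀ p ∈ supported k0 T, ψ p = 0 → p = 0) (g : m → MvPolynomial σ k0)
    (hg : ∀ i, ψ (g i) = 0) (N : Matrix m σ E) (hN : ∀ i j, N i j = ψ (pderiv j (g i))) :
    N.rank ≤ (N.submatrix id (Subtype.val : (Tᶜ : Set σ) → σ)).rank := by
  classical
  apply rank_le_of_kernel
  have hai : AlgebraicIndependent k0 (fun b : T => ψ (X (b : σ))) := by
    rw [algebraicIndependent_iff]
    intro p hp
    have h1 : ψ (rename Subtype.val p) = 0 := by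
      rw [← hp]
      have : ψ.comp (rename Subtype.val) = aeval (fun b : T => ψ (X (b : σ))) := by
        ext; simp
      rw [← this]; rfl
    have h2 : rename (Subtype.val : T → σ) p = 0 := by
      refine hT _ ?_ h1
      rw [supported_eq_range_rename]
      exact ⟨p, rfl⟩
    exact rename_injective _ Subtype.val_injective (by simpa using h2)
  intro b hb
  obtain ⟨D, h1, h2⟩ := exists_derivation_of_algInd _ hai ⟨b, hb⟩
  refine ⟨fun l => D (ψ (X l)), h1, fun l hl hlb => h2 ⟨l, hl⟩ (by simpa using hlb), ?_⟩
  ext i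
  simp only [Matrix.mulVec, dotProduct, hN, Pi.zero_apply]
  rw [← derivation_chain, hg, map_zero]

/-- apply a linear functional to all coefficients -/
def coeffFun {σ : Type} (l : ℂ →ₗ[ℚ] ℚ) (g : MvPolynomial σ ℂ) : MvPolynomial σ ℚ :=
  ∑ m ∈ g.support, monomial m (l (coeff m g))

theorem coeff_coeffFun {σ : Type} (l : ℂ →ₗ[ℚ] ℚ) (g : MvPolynomial σ ℂ) (m : σ →₀ ℕ) :
    coeff m (coeffFun l g) = l (coeff m g) := by
  classical
  simp only [coeffFun, coeff_sum, coeff_monomial, Finset.sum_ite_eq', mem_support_iff]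
  split_ifs with h
  · rfl
  · push Not at h; simp [h]

theorem coeffFun_mem {σ : Type} [Finite σ] (I : Ideal (MvPolynomial σ ℚ)) (hI : I.IsRadical)
    (g : MvPolynomial σ ℂ)
    (hg : ∀ z : σ → ℂ, (∀ p ∈ I, aeval z p = 0) → eval z g = 0) (l : ℂ →ₗ[ℚ] ℚ) :
    coeffFun l g ∈ I := by
  classical
  rw [← hI.radical, Ideal.radical_eq_jacobson, Ideal.jacobson, Ideal.mem_sInf]
  rintro M ⟨hIM, hM⟩
  let _ : Field (MvPolynomial σ ℚ ⧸ M) := Ideal.Quotient.field M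
  have _ : Module.Finite ℚ (MvPolynomial σ ℚ ⧸ M) :=
    finite_of_finite_type_of_isJacobsonRing ℚ (MvPolynomial σ ℚ ⧸ M)
  rw [← Ideal.Quotient.eq_zero_iff_mem]
  set π := Ideal.Quotient.mkₐ ℚ M with hπ
  have key : ∀ u, Algebra.trace ℚ (MvPolynomial σ ℚ ⧸ M) (u * π (coeffFun l g)) = 0 := by
    intro u
    have h1 : ∀ τ : (MvPolynomial σ ℚ ⧸ M) →ₐ[ℚ] ℂ,
        ∑ m ∈ g.support, coeff m g * τ (u * π (monomial m 1)) = 0 := by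
      intro τ
      have h2 : eval (fun i => τ (π (X i))) g = 0 := by
        apply hg
        intro p hp
        have h3 : (aeval fun i => τ (π (X i))) = τ.comp π := by ext; simp
        rw [h3]
        have : π p = 0 := Ideal.Quotient.eq_zero_iff_mem.2 (hIM hp)
        simp [this]
      rw [eval_eq] at h2
      have h4 : ∀ m : σ →₀ ℕ, τ (π (monomial m 1)) = ∏ i ∈ m.support, (τ (π (X i))) ^ m i := by
        intro m
        rw [monomial_eq, C_1, one_mul, Finsupp.prod, map_prod, map_prod]
        simp only [map_pow]
      calc ∑ m ∈ g.support, coeff m g * τ (u * π (monomial m 1))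
          = τ u * ∑ m ∈ g.support, coeff m g * ∏ i ∈ m.support, (τ (π (X i))) ^ m i := by
            rw [Finset.mul_sum]
            refine Finset.sum_congr rfl fun m _ => ?_
            rw [map_mul, h4]; ring
        _ = 0 := by rw [h2, mul_zero]
    have h5 : ∑ m ∈ g.support, coeff m g *
        algebraMap ℚ ℂ (Algebra.trace ℚ (MvPolynomial σ ℚ ⧸ M) (u * π (monomial m 1))) = 0 := by
      simp only [trace_eq_sum_embeddings (K := ℚ) (L := MvPolynomial σ ℚ ⧸ M) ℂ, Finset.mul_sum]
      rw [Finset.sum_comm]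
      exact Finset.sum_eq_zero fun τ _ => h1 τ
    have h6 := congrArg l h5
    rw [map_sum, map_zero] at h6
    rw [coeffFun, map_sum, Finset.mul_sum, map_sum, ← h6]
    refine Finset.sum_congr rfl fun m _ => ?_
    rw [mul_comm (coeff m g), ← Algebra.smul_def, map_smul, smul_eq_mul]
    have : monomial m (l (coeff m g)) = (l (coeff m g)) • monomial m (1 : ℚ) := by
      simp [smul_monomial]
    rw [this, map_smul, mul_smul_comm, map_smul, smul_eq_mul, mul_comm]
  by_contra hne
  have h7 := key (π (coeffFun l g))⁻¹
  have hne' : π (coeffFun l g) ≠ 0 := hne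
  rw [inv_mul_cancel₀ hne'] at h7
  have h8 := Algebra.trace_algebraMap (R := ℚ) (S := MvPolynomial σ ℚ ⧸ M) 1
  rw [map_one, h7] at h8
  have : 0 < Module.finrank ℚ (MvPolynomial σ ℚ ⧸ M) := Module.finrank_pos
  rw [nsmul_eq_mul, mul_one, eq_comm, Nat.cast_eq_zero] at h8
  omega

theorem mem_map_of_vanish {σ : Type} [Finite σ] (I : Ideal (MvPolynomial σ ℚ)) (hI : I.IsRadical)
    (g : MvPolynomial σ ℂ)
    (hg : ∀ z : σ → ℂ, (∀ p ∈ I, aeval z p = 0) → eval z g = 0) :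
    g ∈ I.map (MvPolynomial.map (algebraMap ℚ ℂ)) := by
  classical
  let b := Module.Basis.ofVectorSpace ℚ ℂ
  let K := g.support.biUnion fun m => (b.repr (coeff m g)).support
  have h : g = ∑ k ∈ K, C (b k) * MvPolynomial.map (algebraMap ℚ ℂ) (coeffFun (b.coord k) g) := by
    ext m
    simp only [coeff_sum, coeff_C_mul, coeff_map, coeff_coeffFun, Module.Basis.coord_apply]
    by_cases hm : m ∈ g.support
    · conv_lhs => rw [← b.linearCombination_repr (coeff m g)]
      rw [Finsupp.linearCombination_apply, Finsupp.sum_of_support_subset _ (s := K)]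
      · exact Finset.sum_congr rfl fun k _ => by rw [Algebra.smul_def, mul_comm]
      · exact Finset.subset_biUnion_of_mem (fun m => (b.repr (coeff m g)).support) hm
      · simp
    · have : coeff m g = 0 := by simpa using hm
      simp [this]
  rw [h]
  exact sum_mem fun k _ => Ideal.mul_mem_left _ _
    (Ideal.mem_map_of_mem _ (coeffFun_mem I hI g hg _))

theorem eq_zero_of_vanish {σ : Type} [Finite σ] (I : Ideal (MvPolynomial σ ℚ)) (hI : I.IsRadical)
    (T : Set σ) (hT : ∀ p ∈ supported ℚ T, p ∈ I → p = 0)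
    (g : MvPolynomial σ ℂ) (hgT : g ∈ supported ℂ T)
    (hg : ∀ z : σ → ℂ, (∀ p ∈ I, aeval z p = 0) → eval z g = 0) : g = 0 := by
  classical
  let b := Module.Basis.ofVectorSpace ℚ ℂ
  have h0 : ∀ k, coeffFun (b.coord k) g = 0 := by
    intro k
    refine hT _ ?_ (coeffFun_mem I hI g hg _)
    rw [mem_supported] at hgT ⊢
    intro i hi
    apply hgT
    rw [Finset.mem_coe, mem_vars_iff_mem_support] at hi ⊢
    obtain ⟨d, hd, hid⟩ := hi
    refine ⟨d, ?_, hid⟩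
    rw [mem_support_iff, coeff_coeffFun] at hd
    rw [mem_support_iff]
    intro h; simp [h] at hd
  ext m
  rw [coeff_zero]
  apply b.repr.injective
  ext k
  have := congrArg (coeff m) (h0 k)
  rw [coeff_coeffFun] at this
  simpa using this

theorem le_dim_of_algInd {k0 A : Type} [Field k0] [CommRing A] [IsDomain A] [Algebra k0 A]
    [Algebra.FiniteType k0 A] (t : ℕ) (v : Fin t → A) (hv : AlgebraicIndependent k0 v) :
    (t : WithBot (WithTop ℕ)) ≤ ringKrullDim A := by
  obtain ⟨r, φ, hφ, hint⟩ := exists_integral_inj_algHom_of_fg k0 A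
  algebraize [φ.toRingHom]
  have hfs : FaithfulSMul (MvPolynomial (Fin r) k0) A :=
    (faithfulSMul_iff_algebraMap_injective _ _).2 hφ
  have hI : Algebra.IsIntegral (MvPolynomial (Fin r) k0) A := ⟨hint⟩
  have htr : t ≤ r := by
    have h1 := hv.cardinalMk_le_trdeg
    have h2 := trdeg_add_eq k0 (MvPolynomial (Fin r) k0) (A := A)
    rw [MvPolynomial.trdeg_of_isDomain, trdeg_eq_zero, add_zero] at h2
    rw [← h2] at h1
    simpa using h1
  have hr : (r : WithBot (WithTop ℕ)) ≤ ringKrullDim (MvPolynomial (Fin r) k0) := by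
    rw [MvPolynomial.ringKrullDim_of_isNoetherianRing]; simp; exact le_rfl
  obtain ⟨l, hl⟩ := Order.le_krullDim_iff.1 hr
  have hg := Algebra.HasGoingUp.of_isIntegral (R := MvPolynomial (Fin r) k0) (S := A)
  obtain ⟨Q, hQ, hQp, hQl⟩ := Ideal.exists_ideal_over_prime_of_isIntegral_of_isPrime
    (S := A) (RelSeries.head l).asIdeal ⊥ (by
      intro x hx
      have : algebraMap (MvPolynomial (Fin r) k0) A x = 0 := by simpa using hx
      have : x = 0 := hφ (by rw [map_zero]; exact this)
      rw [this]; exact zero_mem _)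
  have : Q.LiesOver (RelSeries.head l).asIdeal := ⟨hQl.symm⟩
  obtain ⟨L, hL, -⟩ := Ideal.exists_ltSeries_of_hasGoingUp l Q
  have h3 : (r : WithBot (WithTop ℕ)) ≤ ringKrullDim A :=
    Order.le_krullDim_iff.2 ⟨L, hL.trans hl⟩
  refine le_trans ?_ h3
  exact_mod_cast htr

theorem le_dim_quot {k0 σ : Type} [Field k0] [Finite σ] (t : ℕ) (v : Fin t → σ)
    (hv : Function.Injective v) (J : Ideal (MvPolynomial σ k0))
    (hJ : ∀ p ∈ supported k0 (Set.range v), p ∈ J → p = 0) :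
    (t : WithBot (WithTop ℕ)) ≤ ringKrullDim (MvPolynomial σ k0 ⧸ J) := by
  let S : Submonoid (MvPolynomial σ k0) :=
    { carrier := {p | p ∈ supported k0 (Set.range v) ∧ p ≠ 0}
      mul_mem' := fun {a b} ha hb => ⟨mul_mem ha.1 hb.1, mul_ne_zero ha.2 hb.2⟩
      one_mem' := ⟨one_mem _, one_ne_zero⟩ }
  have hd : Disjoint (J : Set (MvPolynomial σ k0)) (S : Set (MvPolynomial σ k0)) := by
    rw [Set.disjoint_left]
    intro p hp hS
    exact hS.2 (hJ p hS.1 hp)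
  obtain ⟨P, hP, hJP, hPS⟩ := Ideal.exists_le_prime_disjoint J S hd
  refine le_trans ?_ (ringKrullDim_le_of_surjective (Ideal.Quotient.factor hJP)
    (Ideal.Quotient.factor_surjective hJP))
  refine le_dim_of_algInd (k0 := k0) t (fun l => Ideal.Quotient.mkₐ k0 P (X (v l))) ?_
  rw [algebraicIndependent_iff]
  intro p hp
  have h1 : Ideal.Quotient.mkₐ k0 P (rename v p) = 0 := by
    rw [← hp]
    have : (Ideal.Quotient.mkₐ k0 P).comp (rename v) =
        aeval (fun l => Ideal.Quotient.mkₐ k0 P (X (v l))) := by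
      ext; simp
    rw [← this]; rfl
  by_contra hne
  refine Set.disjoint_left.1 hPS (Ideal.Quotient.eq_zero_iff_mem.1 h1) ⟨?_, ?_⟩
  · rw [supported, Algebra.adjoin_eq_range]
    have := (mem_supported (R := k0) (p := rename v p) (s := Set.range v)).2 (by
      classical
      intro i hi
      obtain ⟨j, _, rfl⟩ := Finset.mem_image.1 (vars_rename v p hi)
      exact ⟨j, rfl⟩)
    rwa [supported, Algebra.adjoin_eq_range] at this
  · intro h
    exact hne (rename_injective _ hv (by simpa using h))

theorem ker_le_tangent {n t s : ℕ} (f : Fin s → MvPolynomial (Fin n ⊕ Fin t) ℚ)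
    (hrad : (Ideal.span (Set.range f)).IsRadical) (z : Fin n ⊕ Fin t → ℂ) (hz : z ∈ VC f)
    (v : Fin n ⊕ Fin t → ℂ)
    (hv : (Matrix.of fun (i : Fin s) j => aeval z (pderiv j (f i))).mulVec v = 0) :
    v ∈ tangentAt (VC f) z := by
  intro g hg
  have h1 : g ∈ (Ideal.span (Set.range f)).map (MvPolynomial.map (algebraMap ℚ ℂ)) := by
    apply mem_map_of_vanish _ hrad
    intro w hw
    apply hg
    rintro _ ⟨i, rfl⟩
    have := hw (f i) (Ideal.subset_span ⟨i, rfl⟩)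
    simpa [toC, eval_map, aeval_def] using this
  rw [Ideal.map_span] at h1
  have h2 : polyDiff z g v = 0 ∧ eval z g = 0 := by
    clear hg
    induction h1 using Submodule.span_induction with
    | mem x hx =>
      obtain ⟨_, ⟨i, rfl⟩, rfl⟩ := hx
      constructor
      · have := congrFun hv i
        simp only [Matrix.mulVec, dotProduct, Matrix.of_apply, Pi.zero_apply] at this
        rw [← this, polyDiff]
        refine Finset.sum_congr rfl fun j _ => ?_
        rw [pderiv_map, eval_map, aeval_def, mul_comm]
      · exact hz _ ⟨i, rfl⟩
    | zero => simp [polyDiff]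
    | add x y hx hy h1 h2 =>
      refine ⟨?_, by simp [h1.2, h2.2]⟩
      have a1 := h1.1
      have a2 := h2.1
      simp only [polyDiff, map_add, mul_add, Finset.sum_add_distrib] at *
      simp [a1, a2]
    | smul a x hx h1 =>
      refine ⟨?_, by simp [h1.2]⟩
      have a1 := h1.1
      simp only [polyDiff] at a1
      have : polyDiff z (a • x) v = eval z a * ∑ j, v j * eval z (pderiv j x) := by
        rw [polyDiff, Finset.mul_sum]
        refine Finset.sum_congr rfl fun j _ => ?_
        simp [h1.2]; ring
      rw [this, a1, mul_zero]
  exact h2.1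

theorem star_lemma {n t s d : ℕ} (f : Fin s → MvPolynomial (Fin n ⊕ Fin t) ℚ)
    (hrad : (Ideal.span (Set.range f)).IsRadical)
    (hsing : setDim (singLocus (VC f) (d + t)) < (t : WithBot (WithTop ℕ))) :
    ∃ q ∈ supported ℚ (Set.range (Sum.inr : Fin t → Fin n ⊕ Fin t)), q ≠ 0 ∧
      q ∈ Ideal.span (Set.range f ∪ minorsGE (jacPolyX f) (n - d) 0) := by
  classical
  by_contra hcon
  have hJ : ∀ p ∈ supported ℚ (Set.range (Sum.inr : Fin t → Fin n ⊕ Fin t)),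
      p ∈ Ideal.span (Set.range f ∪ minorsGE (jacPolyX f) (n - d) 0) → p = 0 := by
    intro p hp hpJ
    by_contra hne
    exact hcon ⟨p, hp, hne, hpJ⟩
  obtain ⟨E, _, _, ψ, hψJ, hψT⟩ := exists_point_of_disjoint _ _ hJ
  have hf : ∀ i, ψ (f i) = 0 := fun i => hψJ _ (Ideal.subset_span (Or.inl ⟨i, rfl⟩))
  have hrk := sard_rank (Set.range (Sum.inr : Fin t → Fin n ⊕ Fin t)) ψ hψT f hf
    (Matrix.of fun i j => ψ (pderiv j (f i))) (fun _ _ => rfl)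
  set N : Matrix (Fin s) (Fin n ⊕ Fin t) E := Matrix.of fun i j => ψ (pderiv j (f i)) with hN
  have hlt : N.rank < n - d := by
    refine lt_of_le_of_lt hrk ?_
    by_contra hge
    push Not at hge
    obtain ⟨r, g, hr, hg, hdet⟩ := exists_minor_ne_zero _ _ hge
    have hc : ∀ l, ∃ c : Fin n, (g l : Fin n ⊕ Fin t) = Sum.inl c := by
      intro l
      rcases h : (g l : Fin n ⊕ Fin t) with c | c
      · exact ⟨c, rfl⟩
      · exact absurd ⟨c, h.symm⟩ (g l).2
    choose c hc using hc
    apply hdet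
    have h0 := hψJ (((jacPolyX f).submatrix r c).det) (Ideal.subset_span (Or.inr
      ⟨r, c, hr, fun a b hab => hg (Subtype.ext (by rw [hc, hc, hab])), fun _ => Nat.zero_le _, rfl⟩))
    rw [AlgHom.map_det] at h0
    rw [← h0]
    congr 1
    ext a b
    simp [jacPolyX, hN, hc]
  have hPprime : (RingHom.ker ψ).IsPrime := RingHom.ker_isPrime ψ
  have hsingz : ∀ z : Fin n ⊕ Fin t → ℂ, (∀ p ∈ RingHom.ker ψ, aeval z p = 0) →
      z ∈ singLocus (VC f) (d + t) := by
    intro z hz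
    have hzV : z ∈ VC f := by
      rintro _ ⟨i, rfl⟩
      have := hz (f i) (hf i)
      simpa [toC, eval_map, aeval_def] using this
    refine ⟨hzV, ?_⟩
    set Z : Matrix (Fin s) (Fin n ⊕ Fin t) ℂ := Matrix.of fun i j => aeval z (pderiv j (f i))
      with hZ
    have hZr : Z.rank < n - d := by
      by_contra hge
      push Not at hge
      obtain ⟨r, g, hr, hg, hdet⟩ := exists_minor_ne_zero _ _ hge
      apply hdet
      have h1 : ψ ((Matrix.of fun i j => pderiv j (f i)).submatrix r g).det = 0 := by
        by_contra hne
        rw [AlgHom.map_det] at hne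
        exact absurd (le_rank_of_minor N _ r g hne) (not_le.2 hlt)
      have h2 := hz _ h1
      rw [AlgHom.map_det] at h2
      exact h2
    have hker : LinearMap.ker Z.mulVecLin ≤ tangentAt (VC f) z := by
      intro v hv
      exact ker_le_tangent f hrad z hzV v (by simpa using hv)
    have h3 := LinearMap.finrank_range_add_finrank_ker Z.mulVecLin
    have h4 := Submodule.finrank_mono hker
    rw [Module.finrank_fintype_fun_eq_card, Fintype.card_sum, Fintype.card_fin,
      Fintype.card_fin] at h3
    have h5 : Z.rank = Module.finrank ℂ (LinearMap.range Z.mulVecLin) := rfl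
    omega
  refine absurd hsing (not_lt.2 ?_)
  refine le_dim_quot t Sum.inr Sum.inr_injective _ ?_
  intro p hp hpv
  refine eq_zero_of_vanish (RingHom.ker ψ) hPprime.isRadical _ (fun p hp h => hψT p hp h) p hp ?_
  intro z hz
  exact hpv z (hsingz z hz)

/-- linear change of variables -/
def linX {n : ℕ} {R : Type} [CommRing R] (A : Matrix (Fin n) (Fin n) R) :
    MvPolynomial (Fin n) R →ₐ[R] MvPolynomial (Fin n) R :=
  aeval (fun j => ∑ k, C (A j k) * X k)

theorem linX_X {n : ℕ} {R : Type} [CommRing R] (A : Matrix (Fin n) (Fin n) R) (j : Fin n) :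
    linX A (X j) = ∑ k, C (A j k) * X k := by
  simp [linX]

theorem linX_C {n : ℕ} {R : Type} [CommRing R] (A : Matrix (Fin n) (Fin n) R) (r : R) :
    linX A (C r) = C r := by
  simp [linX]

theorem linX_linX {n : ℕ} {R : Type} [CommRing R] (A B : Matrix (Fin n) (Fin n) R)
    (p : MvPolynomial (Fin n) R) : linX B (linX A p) = linX (A * B) p := by
  have : (linX B).comp (linX A) = linX (A * B) := by
    ext j : 1
    simp only [AlgHom.comp_apply, linX_X, map_sum, map_mul, linX_C, Matrix.mul_apply,
      Finset.mul_sum, Finset.sum_mul]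
    rw [Finset.sum_comm]
    simp [mul_assoc]
  rw [← this]; rfl

theorem map_linX {n : ℕ} {R S : Type} [CommRing R] [CommRing S] (φ : R →+* S)
    (A : Matrix (Fin n) (Fin n) R) (p : MvPolynomial (Fin n) R) :
    MvPolynomial.map φ (linX A p) = linX (A.map φ) (MvPolynomial.map φ p) := by
  induction p using MvPolynomial.induction_on with
  | C a => simp
  | add p q hp hq => simp [hp, hq]
  | mul_X p i hp => simp [hp, linX_X]

theorem pderiv_linX {n : ℕ} {R : Type} [CommRing R] (A : Matrix (Fin n) (Fin n) R)
    (p : MvPolynomial (Fin n) R) (j : Fin n) :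
    pderiv j (linX A p) = ∑ l, linX A (pderiv l p) * C (A l j) := by
  classical
  induction p using MvPolynomial.induction_on with
  | C a => simp
  | add p q hp hq => simp [hp, hq, add_mul, Finset.sum_add_distrib]
  | mul_X p i hp =>
    have h1 : pderiv j (linX A (X i)) = C (A i j) := by
      rw [linX_X, map_sum, Finset.sum_eq_single j]
      · simp
      · intro b _ hb
        simp [pderiv_X_of_ne hb]
      · simp
    have h2 : ∀ l, linX A (pderiv l (p * X i)) * C (A l j) =
        linX A p * (linX A (pderiv l (X i)) * C (A l j)) +
          linX A (X i) * (linX A (pderiv l p) * C (A l j)) := by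
      intro l
      rw [Derivation.leibniz, smul_eq_mul, smul_eq_mul, map_add, map_mul, map_mul]
      ring
    have h3 : ∑ l, linX A (pderiv l (X i)) * C (A l j) = C (A i j) := by
      rw [Finset.sum_eq_single i]
      · simp
      · intro b _ hb
        rw [pderiv_X_of_ne hb.symm]; simp
      · simp
    rw [map_mul, Derivation.leibniz, hp, h1, Finset.sum_congr rfl fun l _ => h2 l,
      Finset.sum_add_distrib, ← Finset.mul_sum, ← Finset.mul_sum, h3, smul_eq_mul, smul_eq_mul]

/-- the ideal of the system and its truncated minors -/
def sysJ {n s : ℕ} {R : Type} [CommRing R] (g : Fin s → MvPolynomial (Fin n) R) (k i : ℕ) :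
    Ideal (MvPolynomial (Fin n) R) :=
  Ideal.span (Set.range g ∪ minorsGE (jacPoly g) k i)

theorem minorsGE_mono {s n : ℕ} {R : Type} [CommRing R] (M : Matrix (Fin s) (Fin n) R)
    (k : ℕ) {i j : ℕ} (h : i ≤ j) : minorsGE M k j ⊆ minorsGE M k i := by
  rintro q ⟨r, c, hr, hc, hl, rfl⟩
  exact ⟨r, c, hr, hc, fun l => h.trans (hl l), rfl⟩

theorem sysJ_mono {n s : ℕ} {R : Type} [CommRing R] (g : Fin s → MvPolynomial (Fin n) R) (k : ℕ)
    {i j : ℕ} (h : i ≤ j) : sysJ g k j ≤ sysJ g k i :=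
  Ideal.span_mono (Set.union_subset_union_right _ (minorsGE_mono _ _ h))

theorem image_sysJ {n s : ℕ} {R S : Type} [CommRing R] [CommRing S]
    (Φ : MvPolynomial (Fin n) R →+* MvPolynomial (Fin n) S)
    (g : Fin s → MvPolynomial (Fin n) R) (k i : ℕ)
    (h : ∀ a (j : Fin n), i ≤ (j : ℕ) → Φ (pderiv j (g a)) = pderiv j (Φ (g a))) :
    (sysJ g k i).map Φ = sysJ (fun a => Φ (g a)) k i := by
  rw [sysJ, Ideal.map_span, sysJ, Set.image_union, ← Set.range_comp]
  congr 2
  have key : ∀ (r : Fin k → Fin s) (c : Fin k → Fin n), (∀ l, i ≤ (c l : ℕ)) →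
      Φ ((jacPoly g).submatrix r c).det =
        ((jacPoly fun a => Φ (g a)).submatrix r c).det := by
    intro r c hl
    rw [RingHom.map_det]
    congr 1
    ext1 a b
    simp [jacPoly, h _ _ (hl b)]
  ext q
  constructor
  · rintro ⟨_, ⟨r, c, hr, hc, hl, rfl⟩, rfl⟩
    exact ⟨r, c, hr, hc, hl, key r c hl⟩
  · rintro ⟨r, c, hr, hc, hl, rfl⟩
    exact ⟨_, ⟨r, c, hr, hc, hl, rfl⟩, key r c hl⟩

theorem map_sysJ {n s : ℕ} {R S : Type} [CommRing R] [CommRing S] (φ : R →+* S)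
    (g : Fin s → MvPolynomial (Fin n) R) (k i : ℕ) :
    (sysJ g k i).map (MvPolynomial.map φ) = sysJ (fun a => MvPolynomial.map φ (g a)) k i :=
  image_sysJ _ g k i fun _ _ _ => (pderiv_map ..).symm

theorem linX_sysJ {n s : ℕ} {R : Type} [CommRing R] (A : Matrix (Fin n) (Fin n) R)
    (g : Fin s → MvPolynomial (Fin n) R) (k i : ℕ)
    (hA : ∀ l j : Fin n, i ≤ (j : ℕ) → A l j = if l = j then 1 else 0) :
    (sysJ g k i).map (linX A).toRingHom = sysJ (fun a => linX A (g a)) k i := by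
  refine image_sysJ _ g k i fun a j hj => ?_
  show linX A _ = pderiv j (linX A (g a))
  rw [pderiv_linX, Finset.sum_eq_single j]
  · simp [hA j j hj]
  · intro b _ hb
    simp [hA b j hj, hb]
  · simp

theorem exists_elim_of_rank {n s : ℕ} {F : Type} [Field F] [CharZero F]
    (g : Fin s → MvPolynomial (Fin n) F) (k : ℕ)
    (H : ∀ (E : Type) [Field E] [Algebra F E] (ψ : MvPolynomial (Fin n) F →ₐ[F] E),
      (∀ a, ψ (g a) = 0) → k ≤ (Matrix.of fun a j => ψ (pderiv j (g a))).rank) (i : ℕ) :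
    ∃ h ∈ supported F {v : Fin n | (v : ℕ) < i}, h ≠ 0 ∧ h ∈ sysJ g k i := by
  classical
  by_contra hcon
  have hJ : ∀ p ∈ supported F {v : Fin n | (v : ℕ) < i}, p ∈ sysJ g k i → p = 0 := by
    intro p hp hpJ
    by_contra hne
    exact hcon ⟨p, hp, hne, hpJ⟩
  obtain ⟨E, _, _, ψ, hψJ, hψT⟩ := exists_point_of_disjoint _ _ hJ
  have hg : ∀ a, ψ (g a) = 0 := fun a => hψJ _ (Ideal.subset_span (Or.inl ⟨a, rfl⟩))
  have h1 := sard_rank _ ψ hψT g hg (Matrix.of fun a j => ψ (pderiv j (g a))) (fun _ _ => rfl)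
  obtain ⟨r, c, hr, hc, hdet⟩ := exists_minor_ne_zero _ k ((H E ψ hg).trans h1)
  apply hdet
  have h0 := hψJ (((jacPoly g).submatrix r (fun l => (c l : Fin n))).det) (Ideal.subset_span (Or.inr
      ⟨r, _, hr, Subtype.val_injective.comp hc, fun l => not_lt.1 (c l).2, rfl⟩))
  rw [AlgHom.map_det] at h0
  exact h0

theorem rank_of_top {n s : ℕ} {K F : Type} [Field K] [Field F] (φ : K →+* F)
    (g : Fin s → MvPolynomial (Fin n) K) (k : ℕ) (hg : sysJ g k 0 = ⊤)
    (A : Matrix (Fin n) (Fin n) F) (hA : IsUnit A.det)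
    (E : Type) [Field E] [Algebra F E] (ψ : MvPolynomial (Fin n) F →ₐ[F] E)
    (h0 : ∀ a, ψ (linX A (MvPolynomial.map φ (g a))) = 0) :
    k ≤ (Matrix.of fun a j => ψ (pderiv j (linX A (MvPolynomial.map φ (g a))))).rank := by
  classical
  let χ : MvPolynomial (Fin n) K →+* E :=
    (ψ.toRingHom.comp (linX A).toRingHom).comp (MvPolynomial.map φ)
  have hχ : ∀ p, χ p = ψ (linX A (MvPolynomial.map φ p)) := fun p => rfl
  have hN : (Matrix.of fun a j => ψ (pderiv j (linX A (MvPolynomial.map φ (g a))))) =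
      (Matrix.of fun (a : Fin s) j => χ (pderiv j (g a))) * A.map (algebraMap F E) := by
    ext a j
    simp only [Matrix.of_apply, Matrix.mul_apply, Matrix.map_apply, hχ, pderiv_linX, map_sum,
      map_mul, pderiv_map]
    refine Finset.sum_congr rfl fun l _ => ?_
    rw [← algebraMap_eq, AlgHom.commutes]
  rw [hN, Matrix.rank_mul_eq_left_of_isUnit_det]
  · by_contra hlt
    have hle : sysJ g k 0 ≤ RingHom.ker χ := by
      rw [sysJ, Ideal.span_le]
      rintro p (⟨a, rfl⟩ | ⟨r, c, hr, hc, -, rfl⟩)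
      · exact h0 a
      · by_contra hne
        apply hlt
        refine le_rank_of_minor _ k r c ?_
        have : χ ((jacPoly g).submatrix r c).det ≠ 0 := hne
        rw [RingHom.map_det] at this
        exact this
    rw [hg] at hle
    have : χ 1 = 0 := hle trivial
    simp at this
  · have := hA.map (algebraMap F E)
    rwa [RingHom.map_det] at this

/-- `p` is monic of degree `e` in the variable `j`, the others being in `T`. -/
def MonicShape {σ F : Type} [CommRing F] (T : Set σ) (j : σ) (e : ℕ) (p : MvPolynomial σ F) :
    Prop :=
  (∀ m ∈ p.support, ∀ v ∈ m.support, v = j ∨ v ∈ T) ∧ coeff (Finsupp.single j e) p = 1 ∧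
    ∀ m ∈ p.support, m j ≤ e ∧ (m j = e → m = Finsupp.single j e)

theorem isIntegral_of_shape {σ F : Type} [CommRing F] (T : Set σ) (j : σ) (e : ℕ)
    (p : MvPolynomial σ F) (hp : MonicShape T j e p) (J : Ideal (MvPolynomial σ F)) (hJ : p ∈ J) :
    IsIntegral (supported F T) (Ideal.Quotient.mk J (X j)) := by
  classical
  nontriviality F
  obtain ⟨h1, h2, h3⟩ := hp
  have hmem : ∀ m ∈ p.support, monomial (m.erase j) (coeff m p) ∈ supported F T := by
    intro m hm
    rw [mem_supported, vars_monomial (by simpa using hm)]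
    intro v hv
    rw [Finset.mem_coe, Finsupp.support_erase, Finset.mem_erase] at hv
    exact (h1 m hm v hv.2).resolve_left hv.1
  let q : Polynomial (supported F T) := ∑ m ∈ p.support.attach,
    Polynomial.monomial (m.1 j) ⟨monomial (m.1.erase j) (coeff m.1 p), hmem m.1 m.2⟩
  have hes : Finsupp.single j e ∈ p.support := by rw [mem_support_iff, h2]; exact one_ne_zero
  refine ⟨q, ?_, ?_⟩
  · apply Polynomial.monic_of_natDegree_le_of_coeff_eq_one e
    · refine Polynomial.natDegree_sum_le_of_forall_le _ _ fun m _ => ?_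
      exact (Polynomial.natDegree_monomial_le _).trans (h3 m.1 m.2).1
    · rw [Polynomial.finsetSum_coeff, Finset.sum_eq_single ⟨Finsupp.single j e, hes⟩]
      · rw [Polynomial.coeff_monomial, if_pos (by simp)]
        ext1
        simp [h2]
      · intro m _ hm
        rw [Polynomial.coeff_monomial, if_neg]
        intro h
        exact hm (Subtype.ext ((h3 m.1 m.2).2 h))
      · simp
  · rw [Polynomial.eval₂_finsetSum]
    have : ∀ m ∈ p.support.attach, Polynomial.eval₂ (algebraMap (supported F T) _)
        (Ideal.Quotient.mk J (X j)) (Polynomial.monomial (m.1 j)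
          (⟨monomial (m.1.erase j) (coeff m.1 p), hmem m.1 m.2⟩ : supported F T)) =
        Ideal.Quotient.mk J (monomial m.1 (coeff m.1 p)) := by
      intro m _
      rw [Polynomial.eval₂_monomial]
      show Ideal.Quotient.mk J (monomial (m.1.erase j) (coeff m.1 p)) * _ = _
      rw [← map_pow, ← map_mul, X_pow_eq_monomial, monomial_mul, mul_one, Finsupp.erase_add_single]
    rw [Finset.sum_congr rfl this, Finset.sum_attach p.support
      (fun m => Ideal.Quotient.mk J (monomial m (coeff m p))), ← map_sum, support_sum_monomial_coeff]
    exact Ideal.Quotient.eq_zero_iff_mem.2 hJ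

theorem shape_of_isIntegral {σ F : Type} [CommRing F] (T : Set σ) (j : σ) (hj : j ∉ T)
    (J : Ideal (MvPolynomial σ F))
    (h : IsIntegral (supported F T) (Ideal.Quotient.mk J (X j))) :
    ∃ p ∈ J, ∃ e, MonicShape T j e p := by
  classical
  obtain ⟨q, hq, h0⟩ := h
  set e := q.natDegree with he
  let p : MvPolynomial σ F := ∑ l ∈ Finset.range (e + 1),
    (q.coeff l : MvPolynomial σ F) * monomial (Finsupp.single j l) 1
  have hc : ∀ (m : σ →₀ ℕ) l, coeff m ((q.coeff l : MvPolynomial σ F) *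
      monomial (Finsupp.single j l) 1) ≠ 0 →
      m j = l ∧ (∀ v ∈ m.support, v = j ∨ v ∈ T) ∧ (l = e → m = Finsupp.single j e) := by
    intro m l hne
    rw [coeff_mul_monomial'] at hne
    split_ifs at hne with hle
    · rw [mul_one] at hne
      have hs : ∀ v, (m - Finsupp.single j l) v ≠ 0 → v ∈ T := by
        intro v hv
        have := (mem_supported.1 (q.coeff l).2)
        apply this
        rw [Finset.mem_coe, mem_vars_iff_mem_support]
        exact ⟨_, mem_support_iff.2 hne, Finsupp.mem_support_iff.2 hv⟩
      have hmj : m j = l := by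
        have h1 : (m - Finsupp.single j l) j = 0 := by
          by_contra h; exact hj (hs j h)
        have h2 := hle j
        simp at h1 h2
        omega
      refine ⟨hmj, ?_, ?_⟩
      · intro v hv
        by_cases hvj : v = j
        · exact Or.inl hvj
        · right
          apply hs
          rw [Finsupp.tsub_apply, Finsupp.single_eq_of_ne hvj]
          simpa using hv
      · intro hl
        rw [hl, he, hq.coeff_natDegree] at hne
        rw [OneMemClass.coe_one, coeff_one] at hne
        have h5 : 0 = m - Finsupp.single j q.natDegree := by
          by_contra h; simp [h] at hne
        have h6 : m ≤ Finsupp.single j e := tsub_eq_zero_iff_le.1 h5.symm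
        exact le_antisymm h6 (hl ▸ hle)
    · exact absurd rfl hne
  have hsup : ∀ m ∈ p.support, m j ≤ e ∧ (∀ v ∈ m.support, v = j ∨ v ∈ T) ∧
      (m j = e → m = Finsupp.single j e) := by
    intro m hm
    rw [mem_support_iff, coeff_sum] at hm
    obtain ⟨l, hl, hne⟩ := Finset.exists_ne_zero_of_sum_ne_zero hm
    obtain ⟨h1, h2, h3⟩ := hc m l hne
    rw [h1]
    exact ⟨by have := Finset.mem_range.1 hl; omega, h2, h3⟩
  refine ⟨p, ?_, e, fun m hm => (hsup m hm).2.1, ?_, fun m hm => ⟨(hsup m hm).1, (hsup m hm).2.2⟩⟩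
  · rw [← Ideal.Quotient.eq_zero_iff_mem, ← h0, Polynomial.eval₂_eq_sum_range, map_sum]
    refine Finset.sum_congr rfl fun l _ => ?_
    rw [map_mul, ← X_pow_eq_monomial, map_pow]
    rfl
  · rw [coeff_sum, Finset.sum_eq_single e]
    · rw [he, hq.coeff_natDegree, OneMemClass.coe_one, one_mul, coeff_monomial, if_pos rfl]
    · intro l _ hl
      by_contra hne
      have := (hc _ l hne).1
      simp at this
      exact hl this.symm
    · simp

theorem isIntegral_transport {σ F F' : Type} [CommRing F] [CommRing F'] (T T' : Set σ)
    (Φ : MvPolynomial σ F →+* MvPolynomial σ F')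
    (hT : ∀ p ∈ supported F T, Φ p ∈ supported F' T') (J : Ideal (MvPolynomial σ F))
    (J' : Ideal (MvPolynomial σ F')) (hJ : J.map Φ ≤ J') (p : MvPolynomial σ F)
    (h : IsIntegral (supported F T) (Ideal.Quotient.mk J p)) :
    IsIntegral (supported F' T') (Ideal.Quotient.mk J' (Φ p)) := by
  have h2 := h.map_of_comp_eq (Φ.restrict (supported F T) (supported F' T') hT)
    (Ideal.quotientMap J' Φ (Ideal.map_le_iff_le_comap.1 hJ)) (by ext x; rfl)
  simpa using h2

theorem isIntegral_trans_image {A B Q : Type} [CommRing A] [CommRing B] [CommRing Q] [Algebra A Q]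
    [Algebra B Q] (h : ∀ b : B, IsIntegral A (algebraMap B Q b)) (x : Q) (hx : IsIntegral B x) :
    IsIntegral A x := by
  let Cl := integralClosure A Q
  let ρ : B →+* Cl := (algebraMap B Q).codRestrict Cl h
  have h2 : IsIntegral Cl x := hx.map_of_comp_eq ρ (RingHom.id _) (by ext x; rfl)
  exact isIntegral_trans _ h2

theorem isIntegral_tower {σ F : Type} [CommRing F] (T T' : Set σ) (J : Ideal (MvPolynomial σ F))
    (hT : ∀ v ∈ T', IsIntegral (supported F T) (Ideal.Quotient.mk J (X v)))
    (p : MvPolynomial σ F) (h : IsIntegral (supported F T') (Ideal.Quotient.mk J p)) :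
    IsIntegral (supported F T) (Ideal.Quotient.mk J p) := by
  have hcl : ∀ q ∈ supported F T', IsIntegral (supported F T) (Ideal.Quotient.mk J q) := by
    intro q hq
    rw [supported] at hq
    induction hq using Algebra.adjoin_induction with
    | mem x hx =>
      obtain ⟨v, hv, rfl⟩ := hx
      exact hT v hv
    | algebraMap r => 
      exact isIntegral_algebraMap (R := supported F T) (A := MvPolynomial σ F ⧸ J)
        (x := algebraMap F (supported F T) r)
    | add x y _ _ hx hy => rw [map_add]; exact hx.add hy
    | mul x y _ _ hx hy => rw [map_mul]; exact hx.mul hy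
  exact isIntegral_trans_image (fun b => hcl b.1 b.2) _ h

theorem exists_point_ne_zero {K F : Type} {n : ℕ} [Field K] [Infinite K] [Field F] (φ : K →+* F)
    (p : MvPolynomial (Fin n) F) (hp : p ≠ 0) : ∃ c : Fin n → K, eval (fun j => φ (c j)) p ≠ 0 := by
  by_contra hcon
  push Not at hcon
  apply hp
  refine funext_set (fun _ => Set.range φ) (fun _ => Set.infinite_range_of_injective φ.injective) ?_
  intro x hx
  choose c hc using fun j => hx j (Set.mem_univ j)
  have := hcon c
  rw [map_zero, ← this]
  congr 2
  ext j; exact (hc j).symm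

theorem coeff_single_of_homogeneous {n D : ℕ} {F : Type} [CommRing F] (p : MvPolynomial (Fin n) F)
    (hp : p.IsHomogeneous D) (a : Fin n) :
    coeff (Finsupp.single a D) p = eval (Pi.single a 1) p := by
  classical
  rw [eval_eq]
  rw [Finset.sum_eq_single (Finsupp.single a D)]
  · rw [Finset.prod_eq_one, mul_one]
    intro i hi
    have : i = a := by
      by_contra h
      rw [Finsupp.mem_support_iff, Finsupp.single_eq_of_ne h] at hi
      exact hi rfl
    subst this; simp
  · intro m hm hne
    have hd := hp (mem_support_iff.1 hm)
    obtain ⟨i, hi, hia⟩ : ∃ i ∈ m.support, i ≠ a := by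
      by_contra hcon
      push Not at hcon
      apply hne
      have h1 : m = Finsupp.single a (m a) := by
        ext i
        by_cases h : i = a
        · subst h; simp
        · rw [Finsupp.single_eq_of_ne h]
          by_contra h'
          exact h (hcon i (Finsupp.mem_support_iff.2 h'))
      rw [h1] at hd
      simp [Finsupp.weight_apply] at hd
      rw [h1, hd]
    rw [Finset.prod_eq_zero hi, mul_zero]
    rw [Pi.single_eq_of_ne hia, zero_pow (Finsupp.mem_support_iff.1 hi)]
  · intro h
    rw [notMem_support_iff.1 h, zero_mul]

theorem eval_linX {n : ℕ} {F : Type} [CommRing F] (A : Matrix (Fin n) (Fin n) F)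
    (p : MvPolynomial (Fin n) F) (x : Fin n → F) : eval x (linX A p) = eval (A.mulVec x) p := by
  induction p using MvPolynomial.induction_on with
  | C a => simp
  | add p q hp hq => simp [hp, hq]
  | mul_X p i hp => simp [hp, linX_X, Matrix.mulVec, dotProduct]

theorem linX_homogeneous {n D : ℕ} {F : Type} [CommRing F] (A : Matrix (Fin n) (Fin n) F)
    (p : MvPolynomial (Fin n) F) (hp : p.IsHomogeneous D) : (linX A p).IsHomogeneous D := by
  have := hp.aeval (fun j => ∑ k, C (A j k) * X k) (n := 1) (fun i => IsHomogeneous.sum _ _ _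
    fun k _ => (isHomogeneous_X _ _).C_mul _)
  rwa [one_mul] at this

theorem linX_top {n : ℕ} {F : Type} [CommRing F] (A : Matrix (Fin n) (Fin n) F)
    (h : MvPolynomial (Fin n) F) (a : Fin n) :
    coeff (Finsupp.single a h.totalDegree) (linX A h) =
      eval (fun l => A l a) (homogeneousComponent h.totalDegree h) ∧
    ∀ m ∈ (linX A h).support, m a ≤ h.totalDegree ∧
      (m a = h.totalDegree → m = Finsupp.single a h.totalDegree) := by
  classical
  have hs : linX A h = ∑ i ∈ Finset.range (h.totalDegree + 1),
      linX A (homogeneousComponent i h) := by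
    rw [← map_sum, sum_homogeneousComponent]
  have hh : ∀ i, (linX A (homogeneousComponent i h)).IsHomogeneous i := fun i =>
    linX_homogeneous A _ (homogeneousComponent_isHomogeneous i h)
  constructor
  · rw [hs, coeff_sum, Finset.sum_eq_single h.totalDegree]
    · rw [coeff_single_of_homogeneous _ (hh _), eval_linX]
      congr 2
      ext l
      simp
    · intro i _ hi
      by_contra hne
      have := hh i hne
      simp [Finsupp.weight_apply] at this
      exact hi this.symm
    · simp
  · intro m hm
    rw [mem_support_iff, hs, coeff_sum] at hm
    obtain ⟨i, hi, hne⟩ := Finset.exists_ne_zero_of_sum_ne_zero hm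
    have h1 := hh i hne
    have h1 : m.degree = i := by
      rw [← h1, Finsupp.degree_eq_weight_one]; rfl
    have h2 : i ≤ h.totalDegree := by have := Finset.mem_range.1 hi; omega
    have h3 := Finsupp.le_degree a m
    refine ⟨by omega, fun h4 => ?_⟩
    have h5 : Finsupp.single a h.totalDegree ≤ m := by
      rw [Finsupp.single_le_iff]; omega
    have h6 : m = Finsupp.single a h.totalDegree + (m - Finsupp.single a h.totalDegree) :=
      (add_tsub_cancel_of_le h5).symm
    have h7 : m.degree = h.totalDegree + (m - Finsupp.single a h.totalDegree).degree := by
      conv_lhs => rw [h6]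
      rw [map_add, Finsupp.degree_single]
    have h8 : (m - Finsupp.single a h.totalDegree).degree = 0 := by omega
    rw [Finsupp.degree_eq_zero_iff] at h8
    rw [h6, h8, add_zero]

theorem vars_linX_shear {n : ℕ} {F : Type} [CommRing F] (a : Fin n) (c : Fin n → F)
    (h : MvPolynomial (Fin n) F) (hh : h ∈ supported F {v : Fin n | (v : ℕ) < (a : ℕ) + 1}) :
    linX ((1 : Matrix (Fin n) (Fin n) F).updateCol a c) h ∈
      supported F {v : Fin n | (v : ℕ) < (a : ℕ) + 1} := by
  rw [supported] at hh
  induction hh using Algebra.adjoin_induction with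
  | mem x hx =>
    obtain ⟨v, hv, rfl⟩ := hx
    rw [linX_X]
    refine sum_mem fun k _ => ?_
    by_cases hk : (k : ℕ) < a + 1
    · exact mul_mem (Subalgebra.algebraMap_mem _ _) (Algebra.subset_adjoin ⟨k, hk, rfl⟩)
    · have h1 : k ≠ a := by rintro rfl; omega
      have h2 : v ≠ k := by rintro rfl; exact hk hv
      rw [Matrix.updateCol_ne h1, Matrix.one_apply_ne h2, C_0, zero_mul]
      exact zero_mem _
  | algebraMap r => rw [AlgHom.commutes]; exact Subalgebra.algebraMap_mem _ _
  | add x y _ _ hx hy => rw [map_add]; exact add_mem hx hy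
  | mul x y _ _ hx hy => rw [map_mul]; exact mul_mem hx hy

theorem noether_step {n s : ℕ} {F : Type} [Field F] (G : Fin s → MvPolynomial (Fin n) F) (k : ℕ)
    (a : Fin n) (c : Fin n → F) (h : MvPolynomial (Fin n) F)
    (hsup : h ∈ supported F {v : Fin n | (v : ℕ) < (a : ℕ) + 1})
    (hJ : h ∈ sysJ G k (a + 1))
    (hc : eval c (homogeneousComponent h.totalDegree h) ≠ 0)
    (IH : ∀ j : Fin n, (a : ℕ) + 1 ≤ j → IsIntegral (supported F {v : Fin n | (v : ℕ) < (a : ℕ) + 1})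
      (Ideal.Quotient.mk (sysJ G k (a + 1 + 1)) (X j))) :
    ∀ j : Fin n, (a : ℕ) ≤ j → IsIntegral (supported F {v : Fin n | (v : ℕ) < (a : ℕ)})
      (Ideal.Quotient.mk (sysJ (fun b => linX ((1 : Matrix (Fin n) (Fin n) F).updateCol a c) (G b))
        k (a + 1)) (X j)) := by
  classical
  set g0 := (1 : Matrix (Fin n) (Fin n) F).updateCol a c with hg0
  set J' := sysJ (fun b => linX g0 (G b)) k (a + 1) with hJ'
  have hcol : ∀ l j : Fin n, (a : ℕ) + 1 ≤ (j : ℕ) → g0 l j = if l = j then 1 else 0 := by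
    intro l j hj
    have : j ≠ a := by rintro rfl; omega
    rw [hg0, Matrix.updateCol_ne this, Matrix.one_apply]
  have hmap : (sysJ G k (a + 1)).map (linX g0).toRingHom = J' := linX_sysJ g0 G k (a + 1) hcol
  obtain ⟨htop, hsh⟩ := linX_top g0 h a
  have hcola : (fun l => g0 l a) = c := by ext l; simp [hg0]
  rw [hcola] at htop
  have ha : IsIntegral (supported F {v : Fin n | (v : ℕ) < (a : ℕ)})
      (Ideal.Quotient.mk J' (X a)) := by
    set u := eval c (homogeneousComponent h.totalDegree h) with hu
    refine isIntegral_of_shape _ a h.totalDegree (C u⁻¹ * linX g0 h) ⟨?_, ?_, ?_⟩ J' ?_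
    · intro m hm v hv
      have hm' : m ∈ (linX g0 h).support := by
        rw [mem_support_iff, coeff_C_mul] at hm
        exact mem_support_iff.2 (right_ne_zero_of_mul hm)
      have h1 := mem_supported.1 (vars_linX_shear a c h hsup)
        (Finset.mem_coe.2 ((mem_vars_iff_mem_support _).2 ⟨m, hm', hv⟩))
      have h2 : (v : ℕ) < a + 1 := h1
      rcases Nat.lt_succ_iff_lt_or_eq.1 h2 with h3 | h3
      · exact Or.inr h3
      · exact Or.inl (Fin.ext h3)
    · rw [coeff_C_mul, htop, inv_mul_cancel₀ hc]
    · intro m hm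
      apply hsh
      rw [mem_support_iff, coeff_C_mul] at hm
      exact mem_support_iff.2 (right_ne_zero_of_mul hm)
    · rw [← hmap]
      exact Ideal.mul_mem_left _ _ (Ideal.mem_map_of_mem _ hJ)
  intro j hj
  by_cases hja : j = a
  · rw [hja]; exact ha
  have hlt : (a : ℕ) + 1 ≤ j := by
    have : (j : ℕ) ≠ a := fun h => hja (Fin.ext h)
    omega
  have h1 := isIntegral_transport _ {v : Fin n | (v : ℕ) < (a : ℕ) + 1} (linX g0).toRingHom
    (fun p hp => vars_linX_shear a c p hp) _ J'
    ((Ideal.map_mono (sysJ_mono G k (Nat.le_succ _))).trans hmap.le) _ (IH j hlt)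
  have h2 : IsIntegral (supported F {v : Fin n | (v : ℕ) < (a : ℕ)})
      (Ideal.Quotient.mk J' (linX g0 (X j))) := by
    refine isIntegral_tower _ _ J' ?_ _ h1
    intro v hv
    have hv : (v : ℕ) < a + 1 := hv
    rcases Nat.lt_succ_iff_lt_or_eq.1 hv with h3 | h3
    · exact isIntegral_algebraMap (R := supported F {v : Fin n | (v : ℕ) < (a : ℕ)})
        (A := MvPolynomial (Fin n) F ⧸ J') (x := ⟨X v, Algebra.subset_adjoin ⟨v, h3, rfl⟩⟩)
    · have : v = a := Fin.ext h3
      rw [this]; exact ha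
  have h3 : X j = linX g0 (X j) - C (c j) * X a := by
    rw [linX_X, Finset.sum_eq_add j a hja]
    · simp [hg0, hja]
    · intro b _ hb
      rw [hg0, Matrix.updateCol_ne hb.2, Matrix.one_apply_ne hb.1.symm, C_0, zero_mul]
    · simp
    · simp
  rw [h3, map_sub, map_mul]
  refine h2.sub (IsIntegral.mul ?_ ha)
  exact isIntegral_algebraMap (R := supported F {v : Fin n | (v : ℕ) < (a : ℕ)})
        (A := MvPolynomial (Fin n) F ⧸ J') (x := algebraMap F _ (c j))

/-- generic matrix -/
def genMat (n : ℕ) (K : Type) [Field K] :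
    Matrix (Fin n) (Fin n) (FractionRing (MvPolynomial (Fin n × Fin n) K)) :=
  (Matrix.mvPolynomialX (Fin n) (Fin n) K).map
    (algebraMap _ (FractionRing (MvPolynomial (Fin n × Fin n) K)))

theorem genMat_det {n : ℕ} {K : Type} [Field K] : IsUnit (genMat n K).det := by
  rw [genMat, isUnit_iff_ne_zero, ← RingHom.mapMatrix_apply, ← RingHom.map_det]
  intro h
  have := IsFractionRing.injective (MvPolynomial (Fin n × Fin n) K)
    (FractionRing (MvPolynomial (Fin n × Fin n) K)) (h.trans (map_zero _).symm)
  exact Matrix.det_mvPolynomialX_ne_zero (Fin n) K this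

theorem exists_theta {n : ℕ} {K : Type} [Field K] (g0 : Matrix (Fin n) (Fin n) K)
    (h0 : IsUnit g0.det) :
    ∃ θ : FractionRing (MvPolynomial (Fin n × Fin n) K) →+*
        FractionRing (MvPolynomial (Fin n × Fin n) K),
      θ.comp (algebraMap K _) = algebraMap K _ ∧
      (genMat n K * g0.map (algebraMap K _)).map θ = genMat n K := by
  classical
  let M : Matrix (Fin n) (Fin n) (MvPolynomial (Fin n × Fin n) K) := Matrix.mvPolynomialX (Fin n) (Fin n) K
  let sub : Matrix (Fin n) (Fin n) K → ((MvPolynomial (Fin n × Fin n) K) →ₐ[K] (MvPolynomial (Fin n × Fin n) K)) := fun B =>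
    aeval (fun q : Fin n × Fin n => (M * B.map (C : K →+* MvPolynomial (Fin n × Fin n) K)) q.1 q.2)
  have hsub : ∀ B : Matrix (Fin n) (Fin n) K, M.map (sub B) = M * B.map (C : K →+* MvPolynomial (Fin n × Fin n) K) := by
    intro B
    ext1 i j
    simp [sub, M, Matrix.mvPolynomialX]
  have hsubmul : ∀ B B' : Matrix (Fin n) (Fin n) K, (M * B.map (C : K →+* MvPolynomial (Fin n × Fin n) K)).map (sub B') = M * (B' * B).map (C : K →+* MvPolynomial (Fin n × Fin n) K) := by
    intro B B'
    have : (M * B.map (C : K →+* MvPolynomial (Fin n × Fin n) K)).map (sub B') = M.map (sub B') * (B.map (C : K →+* MvPolynomial (Fin n × Fin n) K)).map (sub B') := by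
      exact Matrix.map_mul (f := (sub B').toRingHom)
    rw [this, hsub, Matrix.map_mul, Matrix.mul_assoc]
    congr 2
    ext1 i j
    simp [sub]
  have hcomp : ∀ B B' : Matrix (Fin n) (Fin n) K, B' * B = 1 → (sub B').comp (sub B) = AlgHom.id K (MvPolynomial (Fin n × Fin n) K) := by
    intro B B' h
    apply MvPolynomial.algHom_ext
    rintro ⟨i, j⟩
    have h1 : sub B (X (i, j)) = (M * B.map (C : K →+* MvPolynomial (Fin n × Fin n) K)) i j := by simp [sub]
    rw [AlgHom.comp_apply, h1]
    have h2 := congrFun (congrFun (hsubmul B B') i) j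
    rw [Matrix.map_apply] at h2
    rw [h2, h, Matrix.map_one _ (map_zero _) (map_one _), mul_one]
    simp [M, Matrix.mvPolynomialX]
  have hinj : Function.Injective ((algebraMap (MvPolynomial (Fin n × Fin n) K) (FractionRing (MvPolynomial (Fin n × Fin n) K))).comp (sub g0⁻¹).toRingHom) := by
    refine (IsFractionRing.injective (MvPolynomial (Fin n × Fin n) K) (FractionRing (MvPolynomial (Fin n × Fin n) K))).comp ?_
    have := hcomp g0⁻¹ g0 (Matrix.mul_nonsing_inv _ h0)
    exact Function.LeftInverse.injective (g := sub g0) fun x => congrArg (fun f => f x) this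
  refine ⟨IsFractionRing.lift hinj, ?_, ?_⟩
  · ext x
    rw [RingHom.comp_apply, IsScalarTower.algebraMap_apply K (MvPolynomial (Fin n × Fin n) K) (FractionRing (MvPolynomial (Fin n × Fin n) K))]
    erw [IsFractionRing.lift_algebraMap hinj]
    show algebraMap (MvPolynomial (Fin n × Fin n) K) (FractionRing (MvPolynomial (Fin n × Fin n) K)) (sub g0⁻¹ (algebraMap K (MvPolynomial (Fin n × Fin n) K) x)) = _
    rw [AlgHom.commutes]
  · have h1 : genMat n K * g0.map (algebraMap K (FractionRing (MvPolynomial (Fin n × Fin n) K))) = (M * g0.map (C : K →+* MvPolynomial (Fin n × Fin n) K)).map (algebraMap (MvPolynomial (Fin n × Fin n) K) (FractionRing (MvPolynomial (Fin n × Fin n) K))) := by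
      rw [Matrix.map_mul, genMat]
      congr 1
    rw [h1]
    ext1 i j
    have h2 := congrFun (congrFun (hsubmul g0 g0⁻¹) i) j
    rw [Matrix.nonsing_inv_mul _ h0, Matrix.map_one _ (map_zero _) (map_one _), mul_one] at h2
    rw [Matrix.map_apply, Matrix.map_apply]
    erw [IsFractionRing.lift_algebraMap hinj]
    show algebraMap (MvPolynomial (Fin n × Fin n) K) (FractionRing (MvPolynomial (Fin n × Fin n) K)) (((M * g0.map (C : K →+* MvPolynomial (Fin n × Fin n) K)).map (sub g0⁻¹)) i j) = _
    rw [h2]; rfl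

theorem map_mem_supported {σ F F' : Type} [CommRing F] [CommRing F'] (θ : F →+* F') (T : Set σ)
    (p : MvPolynomial σ F) (hp : p ∈ supported F T) :
    MvPolynomial.map θ p ∈ supported F' T := by
  rw [supported] at hp
  induction hp using Algebra.adjoin_induction with
  | mem x hx =>
    obtain ⟨v, hv, rfl⟩ := hx
    rw [map_X]
    exact Algebra.subset_adjoin ⟨v, hv, rfl⟩
  | algebraMap r =>
    rw [algebraMap_eq, map_C]
    exact Subalgebra.algebraMap_mem _ _
  | add x y _ _ hx hy => rw [map_add]; exact add_mem hx hy
  | mul x y _ _ hx hy => rw [map_mul]; exact mul_mem hx hy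

theorem homogeneousComponent_totalDegree_ne_zero {n : ℕ} {F : Type} [CommRing F]
    (h : MvPolynomial (Fin n) F) (hh : h ≠ 0) :
    homogeneousComponent h.totalDegree h ≠ 0 := by
  classical
  have hne : h.support.Nonempty := by rwa [Finset.nonempty_iff_ne_empty, ne_eq, support_eq_empty]
  obtain ⟨m, hm, hmax⟩ := Finset.exists_mem_eq_sup h.support hne (fun m => m.sum fun _ e => e)
  intro h0
  have h1 := congrArg (coeff m) h0
  rw [coeff_homogeneousComponent, if_pos, coeff_zero] at h1
  · exact (mem_support_iff.1 hm) h1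
  · rw [totalDegree, hmax]; rfl

theorem noether_generic {n s : ℕ} {K F : Type} [Field K] [CharZero K] [Field F] [CharZero F]
    (φ : K →+* F) (M : Matrix (Fin n) (Fin n) F) (hM : IsUnit M.det)
    (hθM : ∀ g0 : Matrix (Fin n) (Fin n) K, IsUnit g0.det →
      ∃ θ : F →+* F, θ.comp φ = φ ∧ (M * g0.map φ).map θ = M)
    (g : Fin s → MvPolynomial (Fin n) K) (k : ℕ) (hg : sysJ g k 0 = ⊤) :
    ∀ b a : ℕ, a + b = n → ∀ j : Fin n, a ≤ (j : ℕ) →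
      IsIntegral (supported F {v : Fin n | (v : ℕ) < a})
        (Ideal.Quotient.mk (sysJ (fun c => linX M (MvPolynomial.map φ (g c)))
          k (a + 1)) (X j)) := by
  classical
  intro b
  induction b with
  | zero => intro a ha j hj; exact absurd j.2 (by omega)
  | succ b ih =>
    intro a ha
    have IH := ih (a + 1) (by omega)
    obtain ⟨h, hsup, h0, hJ⟩ := exists_elim_of_rank (fun c => linX M (MvPolynomial.map φ (g c)))
          k (fun E _ _ ψ hψ => rank_of_top φ g k hg M hM E ψ hψ) (a + 1)
    obtain ⟨c, hc⟩ := exists_point_ne_zero φ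
      (X (⟨a, by omega⟩ : Fin n) * homogeneousComponent h.totalDegree h)
      (mul_ne_zero (X_ne_zero _) (homogeneousComponent_totalDegree_ne_zero h h0))
    rw [map_mul, eval_X] at hc
    have hca : c ⟨a, by omega⟩ ≠ 0 := by
      intro h; rw [h, map_zero, zero_mul] at hc; exact hc rfl
    have hdet : IsUnit ((1 : Matrix (Fin n) (Fin n) K).updateCol ⟨a, by omega⟩ c).det := by
      rw [← Matrix.cramer_apply, Matrix.cramer_one]
      exact isUnit_iff_ne_zero.2 hca
    obtain ⟨θ, hθ, hθ'⟩ := hθM _ hdet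
    have key := noether_step (fun c => linX M (MvPolynomial.map φ (g c))) k ⟨a, by omega⟩
      (fun j => φ (c j)) h hsup hJ (right_ne_zero_of_mul hc) IH
    have hmat : ((1 : Matrix (Fin n) (Fin n) F).updateCol ⟨a, by omega⟩ fun j => φ (c j)) =
        ((1 : Matrix (Fin n) (Fin n) K).updateCol ⟨a, by omega⟩ c).map φ := by
      rw [Matrix.map_updateCol, Matrix.map_one _ (map_zero _) (map_one _)]
      rfl
    intro j hj
    have h1 := isIntegral_transport _ {v : Fin n | (v : ℕ) < a} (MvPolynomial.map θ)
      (fun p hp => map_mem_supported θ _ p hp) _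
      (sysJ (fun c => linX M (MvPolynomial.map φ (g c))) k (a + 1)) (by
        rw [map_sysJ, hmat]
        simp only [linX_linX, map_linX, hθ', MvPolynomial.map_map, hθ]
        exact le_rfl) _ (key j hj)
    rw [map_X] at h1
    exact h1

theorem clear_denoms {n : ℕ} {R F : Type} [CommRing R] [IsDomain R] [Field F] [Algebra R F]
    [IsFractionRing R F] (J : Ideal (MvPolynomial (Fin n) R)) (p : MvPolynomial (Fin n) F)
    (hp : p ∈ J.map (MvPolynomial.map (algebraMap R F))) :
    ∃ q ∈ J, ∃ D : R, D ≠ 0 ∧ ∀ m, algebraMap R F (coeff m q) = coeff m p * algebraMap R F D := by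
  let _ : Algebra (MvPolynomial (Fin n) R) (MvPolynomial (Fin n) F) := algebraMvPolynomial
  have hloc := MvPolynomial.isLocalization (σ := Fin n) (nonZeroDivisors R) F
  obtain ⟨x, hqD⟩ := (IsLocalization.mem_map_algebraMap_iff
    ((nonZeroDivisors R).map (C : R →+* MvPolynomial (Fin n) R)) (MvPolynomial (Fin n) F)).1 hp
  obtain ⟨D, hD, hDu⟩ := x.2.2
  refine ⟨x.1.1, x.1.2, D, nonZeroDivisors.ne_zero hD, fun m => ?_⟩
  have h1 := congrArg (coeff m) hqD
  rw [← hDu, algebraMap_def, map_C, mul_comm p, coeff_C_mul, coeff_map, mul_comm] at h1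
  exact h1.symm

theorem spread_out_aux {n s : ℕ} {K F : Type} [Field K] [Field F]
    [Algebra (MvPolynomial (Fin n × Fin n) K) F] [IsFractionRing (MvPolynomial (Fin n × Fin n) K) F]
    (g : Fin s → MvPolynomial (Fin n) K) (k : ℕ) (a : ℕ) (j : Fin n) (hj : a ≤ (j : ℕ))
    (hint : IsIntegral (supported F {v : Fin n | (v : ℕ) < a})
        (Ideal.Quotient.mk (sysJ (fun c => linX ((Matrix.mvPolynomialX (Fin n) (Fin n) K).map
            (algebraMap _ F))
          (MvPolynomial.map ((algebraMap (MvPolynomial (Fin n × Fin n) K) F).comp C) (g c)))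
          k (a + 1)) (X j))) :
    ∃ D : MvPolynomial (Fin n × Fin n) K, D ≠ 0 ∧ ∀ B : Matrix (Fin n) (Fin n) K,
      eval (fun q => B q.1 q.2) D ≠ 0 →
      ∃ p ∈ sysJ (fun c => linX B (g c)) k (a + 1), ∃ e, 0 < e ∧
        MonicShape {v : Fin n | (v : ℕ) < a} j e p := by
  classical
  obtain ⟨p, hp, e, h1, h2, h3⟩ := shape_of_isIntegral _ j (by simpa using hj) _ hint
  have hJ : sysJ (fun c => linX ((Matrix.mvPolynomialX (Fin n) (Fin n) K).map (algebraMap _ F))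
      (MvPolynomial.map ((algebraMap (MvPolynomial (Fin n × Fin n) K) F).comp C) (g c)))
      k (a + 1) = (sysJ (fun c => linX (Matrix.mvPolynomialX (Fin n) (Fin n) K)
        (MvPolynomial.map (C : K →+* MvPolynomial (Fin n × Fin n) K) (g c))) k (a + 1)).map
        (MvPolynomial.map (algebraMap (MvPolynomial (Fin n × Fin n) K)
          F)) := by
    rw [map_sysJ]
    simp only [map_linX, MvPolynomial.map_map]
  rw [hJ] at hp
  obtain ⟨q, hq, D, hD0, hcoe⟩ := clear_denoms _ p hp
  have hinj := IsFractionRing.injective (MvPolynomial (Fin n × Fin n) K) F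
  refine ⟨D, hD0, fun B hB => ?_⟩
  let ε : MvPolynomial (Fin n × Fin n) K →+* K := eval (fun q => B q.1 q.2)
  have hεq : C (ε D)⁻¹ * MvPolynomial.map ε q ∈ sysJ (fun c => linX B (g c)) k (a + 1) := by
    apply Ideal.mul_mem_left
    have := Ideal.mem_map_of_mem (MvPolynomial.map ε) hq
    rw [map_sysJ] at this
    convert this using 2
    funext c
    rw [map_linX, MvPolynomial.map_map]
    have e1 : ε.comp (C : K →+* MvPolynomial (Fin n × Fin n) K) = RingHom.id K := by
      ext x; simp [ε]
    have e2 : (Matrix.mvPolynomialX (Fin n) (Fin n) K).map ε = B := by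
      ext i j; simp [ε, Matrix.mvPolynomialX]
    rw [e1, e2, MvPolynomial.map_id]
  have hsupp : ∀ m ∈ (C (ε D)⁻¹ * MvPolynomial.map ε q).support, m ∈ p.support := by
    intro m hm
    rw [mem_support_iff] at hm ⊢
    intro h
    apply hm
    have h5 := hcoe m
    rw [h, zero_mul] at h5
    have h6 : coeff m q = 0 := hinj (h5.trans (map_zero _).symm)
    rw [coeff_C_mul, coeff_map, h6, map_zero, mul_zero]
  have hshape : MonicShape {v : Fin n | (v : ℕ) < a} j e (C (ε D)⁻¹ * MvPolynomial.map ε q) := by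
    refine ⟨fun m hm => h1 m (hsupp m hm), ?_, fun m hm => h3 m (hsupp m hm)⟩
    have h5 := hcoe (Finsupp.single j e)
    rw [h2, one_mul] at h5
    rw [coeff_C_mul, coeff_map, hinj h5]
    exact inv_mul_cancel₀ hB
  rcases Nat.eq_zero_or_pos e with he | he
  · subst he
    have hone : (C (ε D)⁻¹ * MvPolynomial.map ε q) = 1 := by
      ext m
      rw [coeff_one]
      split_ifs with hm
      · rw [← hm]
        have := hshape.2.1
        rwa [Finsupp.single_zero] at this
      · by_contra hne
        have := hshape.2.2 m (mem_support_iff.2 hne)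
        apply hm
        rw [this.2 (Nat.le_zero.1 this.1), Finsupp.single_zero]
    rw [hone] at hεq
    refine ⟨X j, by simpa using Ideal.mul_mem_left _ (X j) hεq, 1, one_pos, ?_, ?_, ?_⟩
    · intro m hm v hv
      rw [support_X, Finset.mem_singleton] at hm
      subst hm
      left
      simpa [Finsupp.single_apply, eq_comm] using hv
    · exact coeff_X_same _
    · intro m hm
      rw [support_X, Finset.mem_singleton] at hm
      subst hm
      simp
  · exact ⟨_, hεq, e, he, hshape⟩

theorem spread_out {n s : ℕ} {K : Type} [Field K] [CharZero K]
    (g : Fin s → MvPolynomial (Fin n) K) (k : ℕ) (hg : sysJ g k 0 = ⊤) (a : ℕ) (j : Fin n)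
    (hj : a ≤ (j : ℕ)) :
    ∃ D : MvPolynomial (Fin n × Fin n) K, D ≠ 0 ∧ ∀ B : Matrix (Fin n) (Fin n) K,
      eval (fun q => B q.1 q.2) D ≠ 0 →
      ∃ p ∈ sysJ (fun c => linX B (g c)) k (a + 1), ∃ e, 0 < e ∧
        MonicShape {v : Fin n | (v : ℕ) < a} j e p := by
  have han : a + (n - a) = n := by have := j.2; omega
  have hcz : CharZero (FractionRing (MvPolynomial (Fin n × Fin n) K)) :=
    charZero_of_injective_algebraMap (algebraMap K _).injective
  exact spread_out_aux (F := FractionRing (MvPolynomial (Fin n × Fin n) K)) g k a j hj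
    (noether_generic (F := FractionRing (MvPolynomial (Fin n × Fin n) K))
      ((algebraMap (MvPolynomial (Fin n × Fin n) K) _).comp C) _ genMat_det
      (fun g0 h0 => exists_theta g0 h0) g k hg (n - a) a han j hj)

/-- `toKx` as a ring hom -/
def toKxHom (n t : ℕ) : MvPolynomial (Fin n ⊕ Fin t) ℚ →+* MvPolynomial (Fin n) (RatFunc' t) :=
  eval₂Hom ((C : RatFunc' t →+* MvPolynomial (Fin n) (RatFunc' t)).comp
      ((algebraMap (MvPolynomial (Fin t) ℚ) (RatFunc' t)).comp (C : ℚ →+* MvPolynomial (Fin t) ℚ)))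
    (Sum.elim X (fun l => C (algebraMap (MvPolynomial (Fin t) ℚ) (RatFunc' t) (X l))))

theorem toKxHom_apply {n t : ℕ} (p : MvPolynomial (Fin n ⊕ Fin t) ℚ) : toKx p = toKxHom n t p := rfl

theorem toKxHom_inl {n t : ℕ} (j : Fin n) : toKxHom n t (X (Sum.inl j)) = X j := by
  simp [toKxHom]

theorem toKxHom_inr {n t : ℕ} (l : Fin t) : toKxHom n t (X (Sum.inr l)) =
    C (algebraMap (MvPolynomial (Fin t) ℚ) (RatFunc' t) (X l)) := by
  simp [toKxHom]

theorem toKxHom_C {n t : ℕ} (a : ℚ) : toKxHom n t (C a) =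
    C (algebraMap (MvPolynomial (Fin t) ℚ) (RatFunc' t) (C a)) := by
  simp only [toKxHom, coe_eval₂Hom, eval₂_C, RingHom.comp_apply]

theorem toKxHom_pderiv {n t : ℕ} (j : Fin n) (p : MvPolynomial (Fin n ⊕ Fin t) ℚ) :
    toKxHom n t (pderiv (Sum.inl j) p) = pderiv j (toKxHom n t p) := by
  classical
  induction p using MvPolynomial.induction_on with
  | C a => rw [toKxHom_C, pderiv_C, pderiv_C, map_zero]
  | add p q hp hq => rw [map_add, map_add, map_add, map_add, hp, hq]
  | mul_X p i hp =>
    rw [Derivation.leibniz, map_mul, Derivation.leibniz, map_add, smul_eq_mul, smul_eq_mul,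
      smul_eq_mul, smul_eq_mul, map_mul, map_mul, hp]
    congr 2
    rcases i with i | l
    · rw [toKxHom_inl, pderiv_X, pderiv_X]
      by_cases h : i = j
      · subst h; simp
      · rw [Pi.single_eq_of_ne (by simpa using h), Pi.single_eq_of_ne h, map_zero]
    · rw [toKxHom_inr, pderiv_C, pderiv_X, Pi.single_eq_of_ne (by simp), map_zero]

theorem toKxHom_chgX {n t : ℕ} (B : Matrix (Fin n) (Fin n) ℚ)
    (p : MvPolynomial (Fin n ⊕ Fin t) ℚ) :
    toKxHom n t (chgX B p) = linX (B.map (fun q => (q : RatFunc' t))) (toKxHom n t p) := by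
  have hq : ∀ a : ℚ, algebraMap (MvPolynomial (Fin t) ℚ) (RatFunc' t) (C a) = (a : RatFunc' t) := by
    intro a
    exact eq_ratCast ((algebraMap (MvPolynomial (Fin t) ℚ) (RatFunc' t)).comp C) a
  unfold chgX
  induction p using MvPolynomial.induction_on with
  | C a => rw [toKxHom_C, linX_C, aeval_C, algebraMap_eq, toKxHom_C]
  | add p q hp hq => rw [map_add, map_add, map_add, map_add, hp, hq]
  | mul_X p i hp =>
    rw [map_mul, map_mul, map_mul, map_mul, hp, aeval_X]
    congr 1
    rcases i with i | l
    · rw [Sum.elim_inl, map_sum, toKxHom_inl, linX_X]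
      refine Finset.sum_congr rfl fun k _ => ?_
      rw [map_mul, toKxHom_C, toKxHom_inl, hq, Matrix.map_apply]
    · rw [Sum.elim_inr, toKxHom_inr, linX_C]

theorem toKxHom_supported {n t : ℕ} (q : MvPolynomial (Fin n ⊕ Fin t) ℚ)
    (hq : q ∈ supported ℚ (Set.range (Sum.inr : Fin t → Fin n ⊕ Fin t))) (h0 : q ≠ 0) :
    IsUnit (toKxHom n t q) := by
  obtain ⟨r, rfl⟩ : ∃ r : MvPolynomial (Fin t) ℚ, rename Sum.inr r = q := by
    have h1 : supported ℚ (Set.range (Sum.inr : Fin t → Fin n ⊕ Fin t)) ≤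
        (rename (R := ℚ) (Sum.inr : Fin t → Fin n ⊕ Fin t)).range := by
      refine Algebra.adjoin_le ?_
      rintro _ ⟨_, ⟨l, rfl⟩, rfl⟩
      exact ⟨X l, rename_X _ _⟩
    exact h1 hq
  have hr : ∀ r : MvPolynomial (Fin t) ℚ, toKxHom n t (rename Sum.inr r) =
      C (algebraMap (MvPolynomial (Fin t) ℚ) (RatFunc' t) r) := by
    intro r
    induction r using MvPolynomial.induction_on with
    | C a => rw [rename_C, toKxHom_C]
    | add p q hp hq => rw [map_add, map_add, map_add, map_add, hp, hq]
    | mul_X p i hp => rw [map_mul, map_mul, map_mul, map_mul, hp, rename_X, toKxHom_inr]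
  rw [hr]
  refine IsUnit.map C (isUnit_iff_ne_zero.2 fun h => h0 ?_)
  rw [IsFractionRing.injective (MvPolynomial (Fin t) ℚ) (RatFunc' t) (h.trans (map_zero _).symm),
    map_zero]

theorem toKx_top {n t s d : ℕ} (f : Fin s → MvPolynomial (Fin n ⊕ Fin t) ℚ)
    (hrad : (Ideal.span (Set.range f)).IsRadical)
    (hsing : setDim (singLocus (VC f) (d + t)) < (t : WithBot (WithTop ℕ))) :
    sysJ (fun a => toKxHom n t (f a)) (n - d) 0 = ⊤ := by
  obtain ⟨q, hq, hq0, hqJ⟩ := star_lemma f hrad hsing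
  refine Ideal.eq_top_of_isUnit_mem _ ?_ (toKxHom_supported q hq hq0)
  have h1 := Ideal.mem_map_of_mem (toKxHom n t) hqJ
  rw [Ideal.map_span] at h1
  refine Ideal.span_mono ?_ h1
  rw [Set.image_union]
  refine Set.union_subset_union ?_ ?_
  · rw [← Set.range_comp]; exact subset_rfl
  · rintro _ ⟨_, ⟨r, c, hr, hc, hl, rfl⟩, rfl⟩
    refine ⟨r, c, hr, hc, hl, ?_⟩
    rw [RingHom.map_det]
    congr 1
    ext1 x y
    exact toKxHom_pderiv _ _

/-- embedding of `ℚ(y)` in the algebraic closure of `ℂ(y)` -/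
theorem exists_iota (t : ℕ) : Nonempty (RatFunc' t →+*
    AlgebraicClosure (FractionRing (MvPolynomial (Fin t) ℂ))) := by
  have hinj : Function.Injective ((algebraMap (MvPolynomial (Fin t) ℂ)
      (FractionRing (MvPolynomial (Fin t) ℂ))).comp (MvPolynomial.map (algebraMap ℚ ℂ))) :=
    (IsFractionRing.injective _ _).comp (map_injective _ (algebraMap ℚ ℂ).injective)
  exact ⟨(algebraMap (FractionRing (MvPolynomial (Fin t) ℂ)) _).comp (IsFractionRing.lift hinj)⟩

theorem final_aux {n s t d : ℕ} {L : Type} [Field L] [CharZero L] (ι : RatFunc' t →+* L)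
    (f : Fin s → MvPolynomial (Fin n ⊕ Fin t) ℚ)
    (hg : sysJ (fun a => toKxHom n t (f a)) (n - d) 0 = ⊤) :
    ∃ 𝒪t : Set (Matrix (Fin n) (Fin n) L),
      IsZariskiOpenMat 𝒪t ∧ 𝒪t.Nonempty ∧ (∀ A ∈ 𝒪t, IsUnit A.det) ∧
      ∀ B : Matrix (Fin n) (Fin n) ℚ,
        B.map (fun q => (q : L)) ∈ 𝒪t →
        ∀ i : ℕ, 1 ≤ i → i ≤ d + 1 → ∀ j : Fin n, i - 1 ≤ (j : ℕ) →
          ∃ p : MvPolynomial (Fin n) (RatFunc' t),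
            p ∈ Ideal.span
              (Set.range (fun i' => toKx (chgX B (f i'))) ∪
                minorsGE (jacPoly fun i' => toKx (chgX B (f i'))) (n - d) i) ∧
            (∀ m ∈ p.support, ∀ v ∈ m.support, v = j ∨ (v : ℕ) < i - 1) ∧
            ∃ e : ℕ, 0 < e ∧ coeff (Finsupp.single j e) p = 1 ∧
              ∀ m ∈ p.support, m j ≤ e ∧ (m j = e → m = Finsupp.single j e) := by
  classical
  have hex : ∀ (a : ℕ) (j : Fin n), ∃ D : MvPolynomial (Fin n × Fin n) (RatFunc' t), D ≠ 0 ∧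
      (a ≤ (j : ℕ) → ∀ B : Matrix (Fin n) (Fin n) (RatFunc' t),
      eval (fun q => B q.1 q.2) D ≠ 0 →
      ∃ p ∈ sysJ (fun c => linX B (toKxHom n t (f c))) (n - d) (a + 1), ∃ e, 0 < e ∧
        MonicShape {v : Fin n | (v : ℕ) < a} j e p) := by
    intro a j
    by_cases h : a ≤ (j : ℕ)
    · obtain ⟨D, hD, h1⟩ := spread_out _ _ hg a j h
      exact ⟨D, hD, fun _ => h1⟩
    · exact ⟨1, one_ne_zero, fun h' => absurd h' h⟩
  choose D hD0 hD using hex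
  let Dt : MvPolynomial (Fin n × Fin n) (RatFunc' t) :=
    (Matrix.mvPolynomialX (Fin n) (Fin n) (RatFunc' t)).det *
      ∏ a ∈ Finset.range (d + 1), ∏ j : Fin n, D a j
  have hDt : Dt ≠ 0 := by
    refine mul_ne_zero (Matrix.det_mvPolynomialX_ne_zero _ _) ?_
    exact Finset.prod_ne_zero_iff.2 fun a _ => Finset.prod_ne_zero_iff.2 fun j _ => hD0 a j
  refine ⟨{A | eval (fun q => A q.1 q.2) (MvPolynomial.map ι Dt) ≠ 0},
    ⟨{MvPolynomial.map ι Dt}, by simp⟩, ?_, ?_, ?_⟩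
  · by_contra hne
    rw [Set.not_nonempty_iff_eq_empty] at hne
    apply hDt
    apply map_injective ι ι.injective
    rw [map_zero]
    refine MvPolynomial.funext fun x => ?_
    rw [map_zero]
    by_contra hx
    have : (Matrix.of fun i j => x (i, j)) ∈ (∅ : Set (Matrix (Fin n) (Fin n) L)) := by
      rw [← hne]
      exact hx
    exact this
  · intro A hA
    have hA : eval (fun q => A q.1 q.2) (MvPolynomial.map ι Dt) ≠ 0 := hA
    simp only [Dt] at hA
    rw [map_mul, map_mul] at hA
    have h1 := left_ne_zero_of_mul hA
    rw [RingHom.map_det, RingHom.map_det] at h1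
    refine isUnit_iff_ne_zero.2 ?_
    convert h1 using 2
    ext i j
    simp [Matrix.mvPolynomialX]
  · intro B hB i hi hid j hj
    have hB : eval (fun q => B.map (fun q => (q : L)) q.1 q.2) (MvPolynomial.map ι Dt) ≠ 0 := hB
    have h1 : eval (fun q => B.map (fun q => (q : RatFunc' t)) q.1 q.2) Dt ≠ 0 := by
      intro h
      apply hB
      have h2 : (fun q : Fin n × Fin n => B.map (fun q => (q : L)) q.1 q.2) =
          fun q => ι (B.map (fun q => (q : RatFunc' t)) q.1 q.2) := by
        ext q; simp
      have h5 := congrArg ι h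
      rw [map_zero] at h5
      rw [h2, eval_map]
      exact (eval₂_comp ι _ Dt).symm.trans h5
    have h3 : eval (fun q => B.map (fun q => (q : RatFunc' t)) q.1 q.2) (D (i - 1) j) ≠ 0 := by
      intro h
      apply h1
      simp only [Dt]
      rw [map_mul, map_prod, Finset.prod_eq_zero (i := i - 1) (by simp; omega), mul_zero]
      rw [map_prod, Finset.prod_eq_zero (Finset.mem_univ j) h]
    obtain ⟨p, hp, e, he, s1, s2, s3⟩ := hD (i - 1) j hj _ h3
    have hi' : i - 1 + 1 = i := by omega
    rw [hi'] at hp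
    refine ⟨p, ?_, s1, e, he, s2, s3⟩
    simp only [toKxHom_apply, toKxHom_chgX]
    exact hp

/-- Noether position of `(x_i, …, x_n)` for the ideals generated by
`f^A ∪ Δ_i^A` in `ℚ(y)[x]`, for `A` rational in a nonempty Zariski open subset of the
matrices over the algebraic closure of `ℂ(y)`: existence of monic polynomials
`p_{i,j} ∈ ℚ(y)[x_1, …, x_{i-1}, x_j]` in these ideals. -/
theorem statement_8 (n t s d : ℕ) (f : Fin s → MvPolynomial (Fin n ⊕ Fin t) ℚ)
    (hA : AssumpA f d) (hB : AssumpB f) :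
    ∃ 𝒪t : Set (Matrix (Fin n) (Fin n)
        (AlgebraicClosure (FractionRing (MvPolynomial (Fin t) ℂ)))),
      IsZariskiOpenMat 𝒪t ∧ 𝒪t.Nonempty ∧ (∀ A ∈ 𝒪t, IsUnit A.det) ∧
      ∀ B : Matrix (Fin n) (Fin n) ℚ,
        B.map (fun q => (q : AlgebraicClosure (FractionRing (MvPolynomial (Fin t) ℂ)))) ∈ 𝒪t →
        ∀ i : ℕ, 1 ≤ i → i ≤ d + 1 → ∀ j : Fin n, i - 1 ≤ (j : ℕ) →
          ∃ p : MvPolynomial (Fin n) (RatFunc' t),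
            p ∈ Ideal.span
              (Set.range (fun i' => toKx (chgX B (f i'))) ∪
                minorsGE (jacPoly fun i' => toKx (chgX B (f i'))) (n - d) i) ∧
            (∀ m ∈ p.support, ∀ v ∈ m.support, v = j ∨ (v : ℕ) < i - 1) ∧
            ∃ e : ℕ, 0 < e ∧ coeff (Finsupp.single j e) p = 1 ∧
              ∀ m ∈ p.support, m j ≤ e ∧ (m j = e → m = Finsupp.single j e) := by
  obtain ⟨ι⟩ := exists_iota t
  have hcz : CharZero (AlgebraicClosure (FractionRing (MvPolynomial (Fin t) ℂ))) :=
    charZero_of_injective_ringHom ι.injective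
  exact final_aux ι f (toKx_top f hA.1 hA.2.2.2)

end
end

section
/- Let I be an ideal of ℂ[x_1,…,x_n] such that the variables (x_{i+1},…,x_n) are in Noether position with respect to I. Then the restriction to V(I) ⊂ ℂ^n of the projection (x_1,…,x_n) ↦ (x_1,…,x_i) is a proper map onto its image (for the Euclidean topology). -/
open MvPolynomial

noncomputable section

/-- if `(x_{i+1}, …, x_n)` are in Noether position w.r.t. `I`, then the
projection on `(x_1, …, x_i)` restricted to `V(I)` is a proper map. -/
theorem statement_13 (n i : ℕ) (hin : i ≤ n) (I : Ideal (MvPolynomial (Fin n) ℂ))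
    (hintegral : ∀ j : Fin n, i ≤ (j : ℕ) →
      RingHom.IsIntegralElem
        ((Ideal.Quotient.mk I).comp
          (MvPolynomial.rename (Fin.castLE hin)).toRingHom)
        (Ideal.Quotient.mk I (X j)))
    (hcap : ∀ p : MvPolynomial (Fin i) ℂ, MvPolynomial.rename (Fin.castLE hin) p ∈ I → p = 0) :
    ProperOn (projMap n i) {x | ∀ p ∈ I, eval x p = 0} := by
  intro β _
  refine ⟨Metric.ball β 1, Metric.isOpen_ball, Metric.mem_ball_self one_pos, ?_⟩
  have hproj : Continuous (projMap n i) := by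
    refine continuous_pi fun k => ?_
    have hk : (k : ℕ) < n := lt_of_lt_of_le k.2 hin
    simp only [projMap, hk, dif_pos]
    exact continuous_apply _
  have hpe : ∀ x : Fin n → ℂ, projMap n i x = x ∘ Fin.castLE hin := by
    intro x
    funext k
    have hk : (k : ℕ) < n := lt_of_lt_of_le k.2 hin
    simp only [projMap, hk, dif_pos]
    rfl
  have hclosed : IsClosed {x | x ∈ {x : Fin n → ℂ | ∀ p ∈ I, eval x p = 0} ∧
      projMap n i x ∈ closure (Metric.ball β 1)} := by
    refine IsClosed.inter ?_ (isClosed_closure.preimage hproj)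
    have : {x : Fin n → ℂ | ∀ p ∈ I, eval x p = 0} = ⋂ p ∈ I, {x | eval x p = 0} := by
      ext x; simp
    rw [this]
    exact isClosed_biInter fun p _ =>
      isClosed_eq (MvPolynomial.continuous_eval p) continuous_const
  have hK : IsCompact (closure (Metric.ball β 1)) :=
    (isCompact_closedBall β 1).of_isClosed_subset isClosed_closure Metric.closure_ball_subset_closedBall
  have key : ∀ j : Fin n, ∃ B : ℝ, ∀ x : Fin n → ℂ, (∀ p ∈ I, eval x p = 0) →
      projMap n i x ∈ closure (Metric.ball β 1) → ‖x j‖ ≤ B := by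
    intro j
    by_cases hj : i ≤ (j : ℕ)
    · obtain ⟨P, hmon, hP⟩ := hintegral j hj
      have hcoef : ∀ k : ℕ, ∃ D : ℝ, ∀ y ∈ closure (Metric.ball β 1),
          ‖eval y (P.coeff k)‖ ≤ D := fun k =>
        hK.exists_bound_of_continuousOn (MvPolynomial.continuous_eval _).continuousOn
      choose D hD using hcoef
      refine ⟨∑ k ∈ Finset.range P.natDegree, D k + 1, fun x hx hy => ?_⟩
      set y := projMap n i x with hydef
      have hroot : (P.map (eval y)).IsRoot (x j) := by
        let φ : (MvPolynomial (Fin n) ℂ ⧸ I) →+* ℂ := Ideal.Quotient.lift I (eval x) hx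
        have h := congrArg φ hP
        rw [Polynomial.hom_eval₂, map_zero] at h
        have h1 : φ.comp ((Ideal.Quotient.mk I).comp
          (MvPolynomial.rename (Fin.castLE hin)).toRingHom) = eval y := by
          refine RingHom.ext fun q => ?_
          change eval x (MvPolynomial.rename (Fin.castLE hin) q) = eval y q
          rw [MvPolynomial.eval_rename, hydef, hpe]
        have h2 : φ (Ideal.Quotient.mk I (X j)) = x j := by
          change eval x (X j) = x j
          simp
        rw [h1, h2] at h
        rw [Polynomial.IsRoot, Polynomial.eval_map]
        exact h
      have hm : (P.map (eval y)).Monic := hmon.map _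
      have hb := hroot.norm_lt_cauchyBound hm.ne_zero
      have hb2 : ((P.map (eval y)).cauchyBound : ℝ) ≤
          ∑ k ∈ Finset.range P.natDegree, D k + 1 := by
        rw [Polynomial.cauchyBound, hm.leadingCoeff, hmon.natDegree_map]
        have : (Finset.range P.natDegree).sup (fun k => ‖(P.map (eval y)).coeff k‖₊) ≤
            ∑ k ∈ Finset.range P.natDegree, ‖(P.map (eval y)).coeff k‖₊ :=
          Finset.sup_le fun k hk => Finset.single_le_sum
            (f := fun k => ‖(P.map (eval y)).coeff k‖₊) (fun _ _ => zero_le) hk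
        have h3 := NNReal.coe_le_coe.2 this
        have h4 : ∑ k ∈ Finset.range P.natDegree, ‖(P.map (eval y)).coeff k‖ ≤
            ∑ k ∈ Finset.range P.natDegree, D k :=
          Finset.sum_le_sum fun k _ => by
            rw [Polynomial.coeff_map]; exact hD k y hy
        push_cast at h3 ⊢
        simp only [div_one, norm_one] at h3 ⊢
        linarith
      exact (show ‖x j‖ ≤ _ from NNReal.coe_le_coe.2 hb.le).trans hb2
    · push Not at hj
      obtain ⟨B, hB⟩ := hK.exists_bound_of_continuousOn
        (f := fun y : Fin i → ℂ => y ⟨j, hj⟩) (continuous_apply _).continuousOn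
      refine ⟨B, fun x _ hy => ?_⟩
      have := hB _ hy
      rw [hpe] at this
      exact this
  choose B hB using key
  refine (isCompact_univ_pi fun j => isCompact_closedBall (0 : ℂ) (B j)).of_isClosed_subset
    hclosed ?_
  rintro x ⟨hx, hy⟩ j _
  simpa using hB j x hx hy

end
end

section
/- Let f = x_1^2 + y_1 x_2^2 + y_2 x_2 + y_3 ∈ ℚ[y_1,y_2,y_3][x_1,x_2], Δ = y_2^2 − 4 y_1 y_3, and let Z(Φ) = {(y_1,y_2,y_3) ∈ ℝ^3 : (Δ > 0 ∧ y_1 > 0) ∨ (Δ ≠ 0 ∧ y_1 < 0)}. Then Z(Φ) is contained in, and dense in, the projection of V(f) ∩ ℝ^5 onto the coordinates (y_1,y_2,y_3). -/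
open MvPolynomial

noncomputable section

/-- A point that is the start of a ray inside `Z` is in the closure of `Z`. -/
lemma mem_closure_of_ray (Z : Set (Fin 3 → ℝ)) (y : Fin 3 → ℝ) (a b c : ℝ)
    (h : ∀ e : ℝ, 0 < e → ![y 0 + e * a, y 1 + e * b, y 2 + e * c] ∈ Z) : y ∈ closure Z := by
  have hc : Continuous (fun e : ℝ => ![y 0 + e * a, y 1 + e * b, y 2 + e * c]) := by
    refine continuous_pi fun i => ?_
    fin_cases i <;> simp <;> fun_prop
  have ht := (hc.tendsto 0).mono_left (nhdsWithin_le_nhds (s := Set.Ioi (0 : ℝ)))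
  have h0 : ![y 0 + 0 * a, y 1 + 0 * b, y 2 + 0 * c] = y := by
    ext i
    fin_cases i <;> simp
  rw [h0] at ht
  refine mem_closure_of_tendsto ht ?_
  filter_upwards [self_mem_nhdsWithin] with e he
  exact h e he

/-- `Z(Φ)` is contained in and dense in the projection of the real
solutions of `x_1² + y_1 x_2² + y_2 x_2 + y_3 = 0` onto `(y_1, y_2, y_3)`. -/
theorem statement_17 (S Z : Set (Fin 3 → ℝ))
    (hS : S = {y | ∃ x : Fin 2 → ℝ,
        x 0 ^ 2 + y 0 * x 1 ^ 2 + y 1 * x 1 + y 2 = 0})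
    (hZ : Z = {y |
        (y 1 ^ 2 - 4 * y 0 * y 2 > 0 ∧ y 0 > 0) ∨
        (y 1 ^ 2 - 4 * y 0 * y 2 ≠ 0 ∧ y 0 < 0)}) :
    Z ⊆ S ∧ S ⊆ closure Z := by
  subst hS hZ
  constructor
  · intro y hy
    have key : ∃ t : ℝ, 0 ≤ -(y 0 * t ^ 2 + y 1 * t + y 2) := by
      rcases hy with ⟨hD, h0⟩ | ⟨-, h0⟩
      · refine ⟨-y 1 / (2 * y 0), ?_⟩
        have : -(y 0 * (-y 1 / (2 * y 0)) ^ 2 + y 1 * (-y 1 / (2 * y 0)) + y 2)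
            = (y 1 ^ 2 - 4 * y 0 * y 2) / (4 * y 0) := by
          field_simp
          ring
        rw [this]
        exact (div_pos hD (by linarith)).le
      · have ha : 0 < -y 0 := by linarith
        obtain ⟨t, ht⟩ : ∃ t, t = (1 + |y 1| + |y 2|) / (-y 0) + 1 := ⟨_, rfl⟩
        have h1 : 1 ≤ t := by
          have : 0 ≤ (1 + |y 1| + |y 2|) / (-y 0) := by positivity
          linarith
        have h2 : -y 0 * t = 1 + |y 1| + |y 2| + -y 0 := by
          rw [ht, mul_add, mul_div_cancel₀ _ ha.ne', mul_one]
        have h3 : |y 2| ≤ -y 0 * t - y 1 := by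
          have := le_abs_self (y 1)
          linarith
        have h4 := mul_le_mul h1 h3 (abs_nonneg _) (by linarith)
        have h5 := le_abs_self (y 2)
        exact ⟨t, by nlinarith⟩
    obtain ⟨t, ht⟩ := key
    refine ⟨![√(-(y 0 * t ^ 2 + y 1 * t + y 2)), t], ?_⟩
    simp only [Matrix.cons_val_zero, Matrix.cons_val_one]
    rw [Real.sq_sqrt ht]
    ring
  · rintro y ⟨x, hx⟩
    rcases lt_trichotomy (y 0) 0 with h0 | h0 | h0
    · by_cases hD : y 1 ^ 2 - 4 * y 0 * y 2 = 0
      · apply mem_closure_of_ray _ y 0 0 1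
        intro e he
        right
        simp only [Matrix.cons_val]
        refine ⟨?_, by linarith⟩
        have := mul_neg_of_neg_of_pos h0 he
        apply ne_of_gt
        nlinarith
      · exact subset_closure (Or.inr ⟨hD, h0⟩)
    · by_cases h1 : y 1 = 0
      · rw [h0, h1] at hx
        have hy2 : y 2 ≤ 0 := by nlinarith [sq_nonneg (x 0)]
        apply mem_closure_of_ray _ y (-1) 0 (-1)
        intro e he
        right
        simp only [Matrix.cons_val, h0, h1]
        refine ⟨?_, by linarith⟩
        apply ne_of_lt
        nlinarith [mul_nonneg he.le (neg_nonneg.2 hy2), mul_pos he he]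
      · have h1' : 0 < y 1 ^ 2 := by positivity
        rcases le_or_gt 0 (y 2) with h2 | h2
        · apply mem_closure_of_ray _ y (-1) 0 0
          intro e he
          right
          simp only [Matrix.cons_val, h0]
          refine ⟨?_, by linarith⟩
          apply ne_of_gt
          nlinarith [mul_nonneg he.le h2]
        · apply mem_closure_of_ray _ y 1 0 0
          intro e he
          left
          simp only [Matrix.cons_val, h0]
          refine ⟨?_, by linarith⟩
          nlinarith [mul_pos he (neg_pos.2 h2)]
    · have hD : 0 ≤ y 1 ^ 2 - 4 * y 0 * y 2 := by
        have : y 1 ^ 2 - 4 * y 0 * y 2 = (2 * y 0 * x 1 + y 1) ^ 2 + 4 * y 0 * x 0 ^ 2 := by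
          linear_combination (-4 * y 0) * hx
        rw [this]
        positivity
      apply mem_closure_of_ray _ y 0 0 (-1)
      intro e he
      left
      simp only [Matrix.cons_val]
      refine ⟨?_, by linarith⟩
      nlinarith [mul_pos h0 he]

end
end
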